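/- arXiv:2604.21619 — 3 statements merged into one kernel-verified Lean document; each statement's English description precedes it below -/
import Mathlib

section
/- Suppose the characteristic of F is 2, and let D = D_F(B_n) with Jacobson radical J(D). Then for every natural number m, the image in F[W(B_n)] of the m-th power ideal J(D)^m is contained in the F-span of {x_J : J ⊆ {0,…,n−1}, |J| ≤ n − m}. -/
set_option maxHeartbeats 1000000
set_option synthInstance.maxHeartbeats 1000000

/-- Coxeter matrix of type Bₙ, with the 4-bond between the simple reflections indexed 0 and 1,
and 3-bonds between consecutive indices. -/
def BMat (n : ℕ) : CoxeterMatrix (Fin n) where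
  M := Matrix.of fun i j : Fin n =>
    if i = j then 1
    else if min (i : ℕ) (j : ℕ) = 0 ∧ max (i : ℕ) (j : ℕ) = 1 then 4
    else if max (i : ℕ) (j : ℕ) = min (i : ℕ) (j : ℕ) + 1 then 3 else 2
  isSymm := by
    unfold Matrix.IsSymm
    ext i j
    simp only [Matrix.transpose_apply, Matrix.of_apply]
    rcases eq_or_ne i j with rfl | h
    · simp
    · rw [if_neg h, if_neg (Ne.symm h), min_comm (j : ℕ) (i : ℕ), max_comm (j : ℕ) (i : ℕ)]
  diagonal := by simp
  off_diagonal := by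
    intro i j h
    simp only [Matrix.of_apply, if_neg h]
    split_ifs <;> omega

/-- Coxeter matrix of type Dₙ: the simple reflections indexed 0 and 1 each have a 3-bond with
the one indexed 2, consecutive indices from 2 on have 3-bonds, and all other pairs commute. -/
def DMat (n : ℕ) : CoxeterMatrix (Fin n) where
  M := Matrix.of fun i j : Fin n =>
    if i = j then 1
    else if min (i : ℕ) (j : ℕ) = 0 ∧ max (i : ℕ) (j : ℕ) = 2 then 3
    else if 1 ≤ min (i : ℕ) (j : ℕ) ∧ max (i : ℕ) (j : ℕ) = min (i : ℕ) (j : ℕ) + 1 then 3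
    else 2
  isSymm := by
    unfold Matrix.IsSymm
    ext i j
    simp only [Matrix.transpose_apply, Matrix.of_apply]
    rcases eq_or_ne i j with rfl | h
    · simp
    · rw [if_neg h, if_neg (Ne.symm h), min_comm (j : ℕ) (i : ℕ), max_comm (j : ℕ) (i : ℕ)]
  diagonal := by simp
  off_diagonal := by
    intro i j h
    simp only [Matrix.of_apply, if_neg h]
    split_ifs <;> omega

open Classical in
/-- The element `x_J = ∑_{w ∈ X_J} w` of the group algebra, where
`X_J = {w : ℓ(w sᵢ) > ℓ(w) for all i ∈ J}`. -/
noncomputable def descentElt (F : Type*) [Field F] {B W : Type*} [Group W] [Fintype W]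
    {M : CoxeterMatrix B} (cs : CoxeterSystem M W) (J : Set B) : MonoidAlgebra F W :=
  ∑ w : W, if ∀ i ∈ J, cs.length w < cs.length (w * cs.simple i)
    then MonoidAlgebra.of F W w else 0

/-- The descent algebra: the `F`-subalgebra of the group algebra generated by the `x_J`. -/
noncomputable def descentAlgebra (F : Type*) [Field F] {B W : Type*} [Group W] [Fintype W]
    {M : CoxeterMatrix B} (cs : CoxeterSystem M W) : Subalgebra F (MonoidAlgebra F W) :=
  Algebra.adjoin F (Set.range (descentElt F cs))


/-- The `m`-th power of a (left) ideal of a possibly noncommutative ring. -/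
noncomputable def idealPow {R : Type*} [Ring R] (I : Ideal R) : ℕ → Ideal R
  | 0 => ⊤
  | m + 1 => I • idealPow I m


namespace SolB

section Exch
variable {B W : Type*} [Group W] {M : CoxeterMatrix B} (cs : CoxeterSystem M W)

open Classical in
/-- The action of a simple reflection on pairs (group element, sign). -/
noncomputable def act (i : B) : Function.End (W × ZMod 2) :=
  fun p => (cs.simple i * p.1 * cs.simple i, p.2 + if p.1 = cs.simple i then 1 else 0)

lemma conj_pow (i j : B) (l : ℕ) :
    ((cs.simple i * cs.simple j) ^ l)⁻¹ * cs.simple j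
      = cs.simple j * (cs.simple i * cs.simple j) ^ l := by
  induction l with
  | zero => simp
  | succ l ih =>
    rw [pow_succ, mul_inv_rev, mul_assoc, ih, ← pow_succ, pow_succ']
    simp [mul_assoc]

open Classical in
lemma act_pow (i j : B) (k : ℕ) (p : W × ZMod 2) :
    ((act cs i * act cs j) ^ k : Function.End (W × ZMod 2)) p =
      ((cs.simple i * cs.simple j) ^ k * p.1 * ((cs.simple i * cs.simple j) ^ k)⁻¹,
        p.2 + ∑ l ∈ Finset.range (2 * k),
          if p.1 = cs.simple j * (cs.simple i * cs.simple j) ^ l then 1 else 0) := by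
  induction k with
  | zero => simp; rfl
  | succ k ih =>
    rw [pow_succ']
    change act cs i (act cs j (((act cs i * act cs j) ^ k : Function.End (W × ZMod 2)) p)) = _
    rw [ih]
    set r := cs.simple i * cs.simple j with hr
    have hc := conj_pow cs i j k
    rw [← hr] at hc
    have h1 : (r ^ k * p.1 * (r ^ k)⁻¹ = cs.simple j) ↔ p.1 = cs.simple j * r ^ (2 * k) := by
      rw [two_mul, pow_add, ← mul_assoc, ← hc]
      constructor
      · intro h; rw [← h]; group
      · intro h; rw [h]; group
    have h2 : (cs.simple j * (r ^ k * p.1 * (r ^ k)⁻¹) * cs.simple j = cs.simple i) ↔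
        p.1 = cs.simple j * r ^ (2 * k + 1) := by
      have e : cs.simple j * r ^ (2 * k + 1) = (r ^ k)⁻¹ * (cs.simple j * r) * r ^ k := by
        rw [← mul_assoc, hc, show 2 * k + 1 = k + 1 + k by omega, pow_add, pow_succ]
        group
      have e2 : cs.simple j * r = cs.simple j * cs.simple i * cs.simple j := by
        rw [hr, mul_assoc]
      rw [e, e2]
      constructor
      · intro h
        rw [← h]
        simp only [mul_assoc, cs.simple_mul_simple_cancel_left, cs.simple_mul_simple_self]
        group
      · intro h
        rw [h]
        simp only [mul_assoc]
        simp
    simp only [act, h1, h2]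
    rw [show 2 * (k + 1) = 2 * k + 1 + 1 by ring, Finset.sum_range_succ, Finset.sum_range_succ]
    ext1
    · simp only [pow_succ', mul_inv_rev]
      simp only [hr, mul_inv_rev, cs.inv_simple, mul_assoc]
    · simp only [add_assoc]

open Classical in
lemma act_liftable : M.IsLiftable (act cs) := by
  intro i j
  funext p
  rw [act_pow]
  have h := cs.simple_mul_simple_pow i j
  change _ = p
  generalize M.M i j = m at h ⊢
  have h' : ∀ x, (cs.simple i * cs.simple j) ^ (m + x) = (cs.simple i * cs.simple j) ^ x := by
    intro x
    rw [pow_add, h, one_mul]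
  rw [h, two_mul, Finset.sum_range_add]
  have h2 : ∀ x ∈ Finset.range m,
      (if p.1 = cs.simple j * (cs.simple i * cs.simple j) ^ (m + x) then (1 : ZMod 2) else 0) =
      if p.1 = cs.simple j * (cs.simple i * cs.simple j) ^ x then (1 : ZMod 2) else 0 :=
    fun x _ => if_congr (by rw [h']) rfl rfl
  rw [Finset.sum_congr rfl h2, CharTwo.add_self_eq_zero, add_zero, one_mul, inv_one, mul_one]

/-- The lifted action. -/
noncomputable def sgnAct : W →* Function.End (W × ZMod 2) := cs.lift ⟨act cs, act_liftable cs⟩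

open Classical in
lemma sgnAct_word (ω : List B) (p : W × ZMod 2) :
    sgnAct cs (cs.wordProd ω) p =
      (cs.wordProd ω * p.1 * (cs.wordProd ω)⁻¹, p.2 + ((cs.rightInvSeq ω).count p.1 : ℕ)) := by
  induction ω with
  | nil => simp; rfl
  | cons i ω ih =>
    rw [cs.wordProd_cons, map_mul]
    change sgnAct cs (cs.simple i) (sgnAct cs (cs.wordProd ω) p) = _
    rw [ih, sgnAct, cs.lift_apply_simple]
    have h1 : (cs.wordProd ω * p.1 * (cs.wordProd ω)⁻¹ = cs.simple i) ↔
      ((cs.wordProd ω)⁻¹ * cs.simple i * cs.wordProd ω = p.1) := by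
      constructor
      · intro h; rw [← h]; group
      · intro h; rw [← h]; group
    simp only [act, h1, CoxeterSystem.rightInvSeq, List.count_cons, beq_iff_eq]
    ext1
    · simp only [mul_inv_rev, cs.inv_simple, mul_assoc]
    · push_cast
      simp only [add_assoc]

/-- Exchange condition. -/
lemma exchange (ω : List B) (i : B)
    (h : cs.length (cs.wordProd ω * cs.simple i) < cs.length (cs.wordProd ω)) :
    ∃ j < ω.length, cs.wordProd ω * cs.simple i = cs.wordProd (ω.eraseIdx j) := by
  classical
  obtain ⟨ω', hr, hw⟩ := cs.exists_isReduced (cs.wordProd ω * cs.simple i)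
  have hw2 : cs.wordProd (ω'.concat i) = cs.wordProd ω := by
    rw [cs.wordProd_concat, ← hw, cs.simple_mul_simple_cancel_right]
  have hred : cs.IsReduced (ω'.concat i) := by
    unfold CoxeterSystem.IsReduced
    rw [hw2, List.length_concat, ← hr.eq, ← hw]
    rcases cs.length_mul_simple (cs.wordProd ω) i with h' | h' <;> omega
  have hmem : cs.simple i ∈ cs.rightInvSeq (ω'.concat i) := by
    rw [cs.rightInvSeq_concat]; simp
  have hc := List.count_eq_one_of_mem hred.nodup_rightInvSeq hmem
  have e1 := sgnAct_word cs ω (cs.simple i, 0)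
  have e2 := sgnAct_word cs (ω'.concat i) (cs.simple i, 0)
  rw [hw2, e1] at e2
  have e3 := congrArg Prod.snd e2
  simp only [hc] at e3
  have hm : cs.simple i ∈ cs.rightInvSeq ω := by
    by_contra hm
    rw [List.count_eq_zero_of_not_mem hm] at e3
    simp at e3
  obtain ⟨j, hj, hji⟩ := List.getElem_of_mem hm
  refine ⟨j, by simpa using hj, ?_⟩
  rw [← cs.wordProd_mul_getD_rightInvSeq, List.getD_eq_getElem _ _ hj, hji]

/-- `w` has an ascent at `i`. -/
def Up (w : W) (i : B) : Prop := cs.length w < cs.length (w * cs.simple i)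

lemma up_mul (w : W) (i : B) : Up cs (w * cs.simple i) i ↔ ¬ Up cs w i := by
  unfold Up
  rw [cs.simple_mul_simple_cancel_right]
  have := cs.length_mul_simple_ne w i
  omega

lemma lifting0 (w : W) (a i : B) (h1 : Up cs w i) (h2 : ¬ Up cs (cs.simple a * w) i) :
    cs.simple a * w = w * cs.simple i := by
  obtain ⟨ω, hr, rfl⟩ := cs.exists_isReduced w
  rw [← cs.wordProd_cons] at h2 ⊢
  have h3 : cs.length (cs.wordProd (a :: ω) * cs.simple i) < cs.length (cs.wordProd (a :: ω)) := by
    have := cs.length_mul_simple_ne (cs.wordProd (a :: ω)) i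
    unfold Up at h2
    omega
  obtain ⟨j, hj, e⟩ := exchange cs _ _ h3
  cases j with
  | zero =>
    simp only [List.eraseIdx_cons_zero] at e
    rw [← e, cs.simple_mul_simple_cancel_right]
  | succ j =>
    exfalso
    rw [List.eraseIdx_cons_succ, cs.wordProd_cons, cs.wordProd_cons, mul_assoc] at e
    have e := mul_left_cancel e
    unfold Up at h1
    rw [e] at h1
    have := cs.length_wordProd_le (ω.eraseIdx j)
    have h4 := hr.eq
    simp only [List.length_cons] at hj
    rw [List.length_eraseIdx_of_lt (by omega)] at this
    omega

lemma lifting (w : W) (a i : B) (h : ¬ (Up cs w i ↔ Up cs (cs.simple a * w) i)) :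
    cs.simple a * w = w * cs.simple i := by
  by_cases h1 : Up cs w i
  · exact lifting0 cs w a i h1 (by tauto)
  · have := lifting0 cs (cs.simple a * w) a i (by tauto)
      (by rw [cs.simple_mul_simple_cancel_left]; exact h1)
    rw [cs.simple_mul_simple_cancel_left] at this
    have e := congrArg (fun x => x * cs.simple i) this
    simp only [cs.simple_mul_simple_cancel_right] at e
    exact e.symm

/-- Same ascents in `K`. -/
def Same (K : Set B) (g h : W) : Prop := ∀ k ∈ K, (Up cs g k ↔ Up cs h k)

/-- Suffix property. -/
lemma suffix (D : Set B) (g : W) (hD : ∀ k ∈ D, ¬ Up cs g k) (ω : List B)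
    (hω : ∀ k ∈ ω, k ∈ D) (hr : cs.IsReduced ω) :
    ∃ a : W, g = a * cs.wordProd ω ∧ cs.length g = cs.length a + ω.length := by
  induction ω using List.reverseRecOn with
  | nil => exact ⟨g, by simp, by simp⟩
  | append_singleton ω i ih =>
    have hr' : cs.IsReduced ω := by
      have := hr.take ω.length
      simpa using this
    obtain ⟨a, rfl, hl⟩ := ih (fun k hk => hω k (by simp [hk])) hr'
    obtain ⟨α, hα, rfl⟩ := cs.exists_isReduced a
    have hi : ¬ Up cs (cs.wordProd α * cs.wordProd ω) i := hD i (hω i (by simp))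
    have h3 : cs.length (cs.wordProd (α ++ ω) * cs.simple i) < cs.length (cs.wordProd (α ++ ω)) := by
      have := cs.length_mul_simple_ne (cs.wordProd (α ++ ω)) i
      rw [← cs.wordProd_append] at hi
      unfold Up at hi
      omega
    obtain ⟨j, hj, e⟩ := exchange cs _ _ h3
    rcases lt_or_ge j α.length with hja | hja
    · rw [List.eraseIdx_append_of_lt_length hja, cs.wordProd_append, cs.wordProd_append] at e
      have e2 : cs.wordProd α * cs.wordProd ω
          = cs.wordProd (α.eraseIdx j) * cs.wordProd (ω ++ [i]) := by
        rw [cs.wordProd_append, cs.wordProd_singleton, ← mul_assoc, ← e,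
          cs.simple_mul_simple_cancel_right]
      refine ⟨_, e2, ?_⟩
      have h4 := cs.length_wordProd_le (α.eraseIdx j)
      rw [List.length_eraseIdx_of_lt hja] at h4
      have h5 := hα.eq
      have h6 := cs.length_mul_le (cs.wordProd (α.eraseIdx j)) (cs.wordProd (ω ++ [i]))
      rw [← e2, hr.eq] at h6
      simp only [List.length_append, List.length_singleton] at h6 ⊢
      omega
    · exfalso
      rw [List.eraseIdx_append_of_length_le hja, cs.wordProd_append, cs.wordProd_append,
        mul_assoc] at e
      have e := mul_left_cancel e
      have h7 := hr.eq
      rw [cs.wordProd_append, cs.wordProd_singleton, e] at h7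
      have h4 := cs.length_wordProd_le (ω.eraseIdx (j - α.length))
      simp only [List.length_append, List.length_singleton] at h7 hj
      rw [List.length_eraseIdx_of_lt (by omega)] at h4
      omega

/-- Terminal elements lie in `W_D`. -/
lemma rotate (D : Set B) (g : W)
    (ht : ∀ a, cs.length (cs.simple a * g) < cs.length g →
      ∃ k ∈ D, cs.simple a * g = g * cs.simple k) :
    ∀ (ω δ : List B), (∀ k ∈ δ, k ∈ D) → g = cs.wordProd (ω ++ δ) →
      cs.IsReduced (ω ++ δ) → ∃ δ' : List B, (∀ k ∈ δ', k ∈ D) ∧ g = cs.wordProd δ' ∧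
        cs.IsReduced δ' := by
  intro ω
  induction ω with
  | nil => intro δ h1 h2 h3; exact ⟨δ, h1, by simpa using h2, by simpa using h3⟩
  | cons a ω ih =>
    intro δ h1 h2 h3
    have e : cs.simple a * g = cs.wordProd (ω ++ δ) := by
      rw [h2, List.cons_append, cs.wordProd_cons, cs.simple_mul_simple_cancel_left]
    have hl : cs.length g = (ω ++ δ).length + 1 := by rw [h2, h3.eq]; simp
    obtain ⟨k, hk, hk2⟩ := ht a (by
      rw [e, hl]
      have := cs.length_wordProd_le (ω ++ δ)
      omega)
    have e3 : g = cs.wordProd (ω ++ (δ ++ [k])) := by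
      rw [← List.append_assoc, cs.wordProd_append, ← e, hk2, cs.wordProd_singleton,
        cs.simple_mul_simple_cancel_right]
    refine ih (δ ++ [k]) ?_ e3 ?_
    · intro k' hk'
      rcases List.mem_append.1 hk' with h | h
      · exact h1 _ h
      · rw [List.mem_singleton.1 h]; exact hk
    · unfold CoxeterSystem.IsReduced
      rw [← e3, hl]; simp; omega

lemma terminal_unique (D : Set B) (g h : W)
    (hg : ∀ k ∈ D, ¬ Up cs g k) (hh : ∀ k ∈ D, ¬ Up cs h k)
    (htg : ∀ a, cs.length (cs.simple a * g) < cs.length g →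
      ∃ k ∈ D, cs.simple a * g = g * cs.simple k)
    (hth : ∀ a, cs.length (cs.simple a * h) < cs.length h →
      ∃ k ∈ D, cs.simple a * h = h * cs.simple k) : g = h := by
  obtain ⟨ω, hr, e⟩ := cs.exists_isReduced g
  obtain ⟨ω', h1, h2, h3⟩ := rotate cs D g htg ω [] (by simp) (by simpa using e) (by simpa using hr)
  obtain ⟨η, hr', e'⟩ := cs.exists_isReduced h
  obtain ⟨η', h1', h2', h3'⟩ :=
    rotate cs D h hth η [] (by simp) (by simpa using e') (by simpa using hr')
  obtain ⟨a, ha, hla⟩ := suffix cs D g hg η' h1' h3'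
  obtain ⟨b, hb, hlb⟩ := suffix cs D h hh ω' h1 h3
  rw [← h3.eq, ← h2] at hlb
  rw [← h3'.eq, ← h2'] at hla
  have : cs.length a = 0 := by omega
  rw [cs.length_eq_zero_iff] at this
  rw [ha, this, one_mul, ← h2']

/-- A function invariant under `Same`-preserving left multiplications is a function of `Same`. -/
lemma invariant {X : Type*} (K : Set B) (c : W → X)
    (hc : ∀ g a, Same cs K g (cs.simple a * g) → c g = c (cs.simple a * g))
    (g h : W) (hs : Same cs K g h) : c g = c h := by
  have key : ∀ N : ℕ, ∀ g : W, cs.length g ≤ N → ∃ g', Same cs K g g' ∧ c g = c g' ∧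
      ∀ a, cs.length (cs.simple a * g') < cs.length g' →
      ∃ k ∈ {k | k ∈ K ∧ ¬ Up cs g k}, cs.simple a * g' = g' * cs.simple k := by
    intro N
    induction N with
    | zero =>
      intro g hg
      exact ⟨g, fun _ _ => Iff.rfl, rfl, fun a ha => by omega⟩
    | succ N ih =>
      intro g hg
      by_cases hx : ∃ a, cs.length (cs.simple a * g) < cs.length g ∧ Same cs K g (cs.simple a * g)
      · obtain ⟨a, ha, hsa⟩ := hx
        obtain ⟨g', h1, h2, h3⟩ := ih (cs.simple a * g) (by omega)
        refine ⟨g', fun k hk => (hsa k hk).trans (h1 k hk), (hc g a hsa).trans h2, ?_⟩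
        intro b hb
        obtain ⟨k, hk, e⟩ := h3 b hb
        exact ⟨k, ⟨hk.1, fun hu => hk.2 ((hsa k hk.1).1 hu)⟩, e⟩
      · refine ⟨g, fun _ _ => Iff.rfl, rfl, fun a ha => ?_⟩
        have : ¬ Same cs K g (cs.simple a * g) := fun h => hx ⟨a, ha, h⟩
        unfold Same at this
        push Not at this
        obtain ⟨k, hk, hk2⟩ := this
        have e := lifting cs g a k (by tauto)
        refine ⟨k, ⟨hk, ?_⟩, e⟩
        unfold Up
        rw [← e]; omega
  obtain ⟨g', a1, a2, a3⟩ := key _ g le_rfl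
  obtain ⟨h', b1, b2, b3⟩ := key _ h le_rfl
  rw [a2, b2]
  congr 1
  have hset : {k | k ∈ K ∧ ¬ Up cs h k} = {k | k ∈ K ∧ ¬ Up cs g k} := by
    ext k
    simp only [Set.mem_ofPred_eq]
    constructor
    · rintro ⟨x, y⟩; exact ⟨x, by rwa [hs k x]⟩
    · rintro ⟨x, y⟩; exact ⟨x, by rwa [← hs k x]⟩
  rw [hset] at b3
  refine terminal_unique cs _ g' h' ?_ ?_ a3 b3
  · rintro k ⟨hk, hk2⟩; rwa [← a1 k hk]
  · rintro k ⟨hk, hk2⟩; rwa [← b1 k hk, ← hs k hk]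

end Exch

section Alg
variable (F : Type*) [Field F] {B W : Type*} [Group W] [Fintype W]
  {M : CoxeterMatrix B} (cs : CoxeterSystem M W)

open Classical in
lemma coeff_descentElt (J : Set B) (g : W) :
    (descentElt F cs J).coeff g = if ∀ i ∈ J, Up cs g i then 1 else 0 := by
  unfold descentElt Up
  rw [MonoidAlgebra.coeff_sum, Finsupp.finsetSum_apply, Finset.sum_eq_single g]
  · split_ifs <;> simp
  · intro b _ hb
    split_ifs <;> simp [hb]
  · simp

open Classical in
lemma coeff_mul_descentElt (J K : Set B) (g : W) :
    (descentElt F cs J * descentElt F cs K).coeff g =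
      ∑ u : W, (if ∀ i ∈ J, Up cs u i then (1 : F) else 0) *
        (if ∀ i ∈ K, Up cs (u⁻¹ * g) i then (1 : F) else 0) := by
  rw [MonoidAlgebra.coeff_mul_apply_left, Finsupp.sum_fintype _ _ (by simp)]
  simp only [coeff_descentElt]

lemma coeff_step (J K : Set B) (g : W) (a : B) (hs : Same cs K g (cs.simple a * g)) :
    (descentElt F cs J * descentElt F cs K).coeff g =
      (descentElt F cs J * descentElt F cs K).coeff (cs.simple a * g) := by
  classical
  rw [coeff_mul_descentElt, coeff_mul_descentElt]
  set P : W → Prop := fun u => ∀ i ∈ J, Up cs u i with hP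
  let σ : W → W := fun u => if (P (cs.simple a * u) ↔ P u) then cs.simple a * u else u
  have hσ : Function.Involutive σ := by
    intro u
    by_cases h : P (cs.simple a * u) ↔ P u
    · have h' : P (cs.simple a * (cs.simple a * u)) ↔ P (cs.simple a * u) := by
        rw [cs.simple_mul_simple_cancel_left]; exact h.symm
      simp only [σ, if_pos h, if_pos h']
      rw [cs.simple_mul_simple_cancel_left]
    · simp only [σ, if_neg h]
  refine Fintype.sum_equiv hσ.toPerm _ _ ?_
  intro u
  rw [Function.Involutive.coe_toPerm]
  by_cases h : P (cs.simple a * u) ↔ P u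
  · simp only [σ, if_pos h]
    have e : (cs.simple a * u)⁻¹ * (cs.simple a * g) = u⁻¹ * g := by group
    rw [e]
    congr 1
    exact if_congr h.symm rfl rfl
  · simp only [σ, if_neg h]
    congr 1
    have : ∃ j ∈ J, ¬ (Up cs u j ↔ Up cs (cs.simple a * u) j) := by
      by_contra hn
      push Not at hn
      exact h (forall₂_congr fun j hj => (hn j hj).symm)
    obtain ⟨j, hj, hn⟩ := this
    have e := lifting cs u a j hn
    have e2 : u⁻¹ * (cs.simple a * g) = cs.simple j * (u⁻¹ * g) := by
      have : cs.simple a = u * cs.simple j * u⁻¹ := by rw [← e]; group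
      rw [this]; group
    rw [e2]
    refine if_congr (forall₂_congr fun k hk => ?_) rfl rfl
    by_contra hx
    have e3 := lifting cs _ _ _ hx
    have e4 : cs.simple a * g = g * cs.simple k := by
      rw [← e2] at e3
      have := congrArg (fun x => u * x) e3
      simpa [mul_assoc] using this
    have h5 := hs k hk
    rw [e4, up_mul] at h5
    tauto

open Classical in
/-- Indicator elements. -/
noncomputable def yElt (A D : Set B) : MonoidAlgebra F W :=
  ∑ w : W, if (∀ i ∈ A, Up cs w i) ∧ (∀ i ∈ D, ¬ Up cs w i) then MonoidAlgebra.of F W w else 0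

lemma yElt_mem (K : Set B) (D : Set B) (hD : D.Finite) : ∀ A : Set B, A ⊆ K → D ⊆ K →
    yElt F cs A D ∈ Submodule.span F {x | ∃ L ⊆ K, x = descentElt F cs L} := by
  classical
  induction D, hD using Set.Finite.induction_on with
  | empty =>
    intro A hA _
    refine Submodule.subset_span ⟨A, hA, ?_⟩
    unfold yElt descentElt Up
    simp
  | @insert i D hi hD ih =>
    intro A hA hDK
    have hiK : i ∈ K := hDK (Set.mem_insert _ _)
    have hDK' : D ⊆ K := fun x hx => hDK (Set.mem_insert_of_mem _ hx)
    have e : yElt F cs A (insert i D) = yElt F cs A D - yElt F cs (insert i A) D := by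
      unfold yElt
      rw [← Finset.sum_sub_distrib]
      refine Finset.sum_congr rfl fun w _ => ?_
      simp only [Set.forall_mem_insert]
      by_cases h1 : ∀ i ∈ A, Up cs w i <;> by_cases h2 : ∀ i ∈ D, ¬ Up cs w i <;>
        by_cases h3 : Up cs w i <;> simp [h1, h2, h3]
    rw [e]
    exact Submodule.sub_mem _ (ih A hA hDK')
      (ih _ (Set.insert_subset hiK hA) hDK')

/-- Solomon's theorem. -/
theorem solomon [Finite B] (J K : Set B) :
    descentElt F cs J * descentElt F cs K ∈
      Submodule.span F {x | ∃ L ⊆ K, x = descentElt F cs L} := by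
  classical
  have := Fintype.ofFinite B
  set z := descentElt F cs J * descentElt F cs K with hz
  have hinv : ∀ g h, Same cs K g h → z.coeff g = z.coeff h :=
    fun g h => invariant cs K (fun g => z.coeff g) (fun g a => coeff_step F cs J K g a) g h
  let d : Set B → F := fun D =>
    if h : ∃ g : W, ∀ k ∈ K, (Up cs g k ↔ k ∉ D) then z.coeff h.choose else 0
  have hd : ∀ g : W, d {k | k ∈ K ∧ ¬ Up cs g k} = z.coeff g := by
    intro g
    have h : ∃ g' : W, ∀ k ∈ K, (Up cs g' k ↔ k ∉ {k | k ∈ K ∧ ¬ Up cs g k}) :=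
      ⟨g, fun k hk => by simp [hk]⟩
    simp only [d, dif_pos h]
    refine hinv _ _ fun k hk => ?_
    rw [h.choose_spec k hk]
    simp [hk]
  have e : z = ∑ D : Set B, if D ⊆ K then d D • yElt F cs (K \ D) D else 0 := by
    ext g
    rw [MonoidAlgebra.coeff_sum, Finsupp.finsetSum_apply,
      Finset.sum_eq_single {k | k ∈ K ∧ ¬ Up cs g k}]
    · rw [if_pos (show {k | k ∈ K ∧ ¬ Up cs g k} ⊆ K from fun k hk => hk.1), MonoidAlgebra.coeff_smul_apply, hd]
      have : (yElt F cs (K \ {k | k ∈ K ∧ ¬ Up cs g k}) {k | k ∈ K ∧ ¬ Up cs g k}).coeff g = 1 := by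
        unfold yElt
        rw [MonoidAlgebra.coeff_sum, Finsupp.finsetSum_apply, Finset.sum_eq_single g]
        · rw [if_pos]
          · simp
          · refine ⟨fun i hi => ?_, fun i hi => hi.2⟩
            by_contra hc
            exact hi.2 ⟨hi.1, hc⟩
        · intro b _ hb
          split_ifs <;> simp [hb]
        · simp
      rw [this]; simp
    · intro D _ hD
      split_ifs with hDK
      · rw [MonoidAlgebra.coeff_smul_apply]
        have : (yElt F cs (K \ D) D).coeff g = 0 := by
          unfold yElt
          rw [MonoidAlgebra.coeff_sum, Finsupp.finsetSum_apply]
          refine Finset.sum_eq_zero fun b _ => ?_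
          split_ifs with hb
          · by_cases hbg : b = g
            · exfalso
              subst hbg
              apply hD
              ext k
              constructor
              · intro hk; exact ⟨hDK hk, hb.2 k hk⟩
              · rintro ⟨hk, hk2⟩
                by_contra hc
                exact hk2 (hb.1 k ⟨hk, hc⟩)
            · simp [hbg]
          · simp
        rw [this]; simp
      · simp
    · simp
  rw [e]
  refine Submodule.sum_mem _ fun D _ => ?_
  split_ifs with hDK
  · exact Submodule.smul_mem _ _ (yElt_mem F cs K D (Set.toFinite D) _ Set.sdiff_subset hDK)
  · exact Submodule.zero_mem _

lemma one_eq : (1 : MonoidAlgebra F W) = descentElt F cs Set.univ := by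
  classical
  ext g
  rw [coeff_descentElt, MonoidAlgebra.one_def, MonoidAlgebra.coeff_single, Finsupp.single_apply]
  refine if_congr ?_ rfl rfl
  constructor
  · rintro rfl i _
    simp [Up]
  · intro h
    by_contra hg
    obtain ⟨i, hi⟩ := cs.exists_rightDescent_of_ne_one (Ne.symm hg)
    have := h i trivial
    unfold Up at this
    unfold CoxeterSystem.IsRightDescent at hi
    omega

/-- The descent algebra acts on spans of `x_L`, for `L` in a lower set. -/
lemma mul_mem_span [Finite B] (S : Set (Set B)) (hS : IsLowerSet S) (r y : MonoidAlgebra F W)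
    (hr : r ∈ descentAlgebra F cs) (hy : y ∈ Submodule.span F (descentElt F cs '' S)) :
    r * y ∈ Submodule.span F (descentElt F cs '' S) := by
  unfold descentAlgebra at hr
  induction hr using Algebra.adjoin_induction generalizing y with
  | mem x hx =>
    obtain ⟨J, rfl⟩ := hx
    induction hy using Submodule.span_induction with
    | mem y hy =>
      obtain ⟨K, hK, rfl⟩ := hy
      refine Submodule.span_mono ?_ (solomon F cs J K)
      rintro _ ⟨L, hL, rfl⟩
      exact ⟨L, hS hL hK, rfl⟩
    | zero => simp
    | add a b _ _ ha hb => rw [mul_add]; exact Submodule.add_mem _ ha hb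
    | smul c a _ ha => rw [mul_smul_comm]; exact Submodule.smul_mem _ _ ha
  | algebraMap c =>
    rw [← Algebra.smul_def]; exact Submodule.smul_mem _ _ hy
  | add a b _ _ ha hb => rw [add_mul]; exact Submodule.add_mem _ (ha y hy) (hb y hy)
  | mul a b _ _ ha hb => rw [mul_assoc]; exact ha _ (hb y hy)

lemma jac_mul [Finite B] (K : Set B) (r : descentAlgebra F cs)
    (hr : r ∈ (⊥ : Ideal (descentAlgebra F cs)).jacobson) :
    (r : MonoidAlgebra F W) * descentElt F cs K ∈
      Submodule.span F (descentElt F cs '' Set.Iio K) := by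
  set N := Submodule.span F (descentElt F cs '' Set.Iio K) with hN
  have h1 : (r : MonoidAlgebra F W) * descentElt F cs K ∈
      Submodule.span F (descentElt F cs '' Set.Iic K) :=
    mul_mem_span F cs _ (isLowerSet_Iic K) _ _ r.2 (Submodule.subset_span ⟨K, Set.mem_Iic.2 le_rfl, rfl⟩)
  rw [← Set.Iio_insert, Set.image_insert_eq] at h1
  have h1' := h1
  rw [Submodule.mem_span_insert] at h1
  obtain ⟨c, z, hz, e⟩ := h1
  rw [← hN] at hz
  by_cases hc : c = 0
  · rw [e, hc, zero_smul, zero_add]; exact hz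
  · obtain ⟨u, hu⟩ := Ideal.mem_jacobson_iff.1 hr (algebraMap F _ (-c⁻¹))
    rw [Ideal.mem_bot, sub_eq_zero] at hu
    have hu2 : (u : MonoidAlgebra F W) * (1 - c⁻¹ • (r : MonoidAlgebra F W)) = 1 := by
      have := congrArg (Subtype.val) hu
      rw [← Algebra.commutes, ← Algebra.smul_def] at this
      simp only [Subalgebra.coe_add, Subalgebra.coe_mul, Subalgebra.coe_smul,
        Subalgebra.coe_one] at this
      rw [mul_sub, mul_one, mul_smul_comm]
      rw [smul_mul_assoc, neg_smul] at this
      refine Eq.trans ?_ this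
      abel
    have hx : descentElt F cs K ∈ N := by
      have e2 : descentElt F cs K = (u : MonoidAlgebra F W) * (-(c⁻¹ • z)) := by
        conv_lhs => rw [← one_mul (descentElt F cs K), ← hu2, mul_assoc, sub_mul, one_mul,
          smul_mul_assoc, e, smul_add, smul_smul, inv_mul_cancel₀ hc, one_smul]
        congr 1
        abel
      rw [e2]
      exact mul_mem_span F cs _ (isLowerSet_Iio K) _ _ u.2
        (Submodule.neg_mem _ (Submodule.smul_mem _ _ hz))
    rw [e]
    exact Submodule.add_mem _ (Submodule.smul_mem _ _ hx) hz

end Alg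

end SolB

/-- If `char F = 2`, the `m`-th power of the Jacobson radical of the descent algebra
`D_F(B_n)`, viewed inside the group algebra, is contained in the `F`-span of the elements `x_J`
with `|J| ≤ n − m`. -/
theorem stmt_10 (F : Type*) [Field F] (n : ℕ) (hn : 2 ≤ n)
    (W : Type*) [Group W] [Fintype W] (cs : CoxeterSystem (BMat n) W)
    (hchar : ringChar F = 2) :
    ∀ m : ℕ,
      Submodule.map (descentAlgebra F cs).val.toLinearMap
          ((idealPow ((⊥ : Ideal ↥(descentAlgebra F cs)).jacobson) m).restrictScalars F) ≤
        Submodule.span F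
          {x : MonoidAlgebra F W | ∃ J : Set (Fin n), J.ncard ≤ n - m ∧ x = descentElt F cs J} := by
  intro m
  rintro _ ⟨r, hr, rfl⟩
  have hr' : r ∈ idealPow ((⊥ : Ideal ↥(descentAlgebra F cs)).jacobson) m := hr
  clear hr
  change (r : MonoidAlgebra F W) ∈ _
  induction m generalizing r with
  | zero =>
    have h := SolB.mul_mem_span F cs Set.univ (fun _ _ _ _ => trivial) r 1 r.2
      (by rw [SolB.one_eq F cs]; exact Submodule.subset_span ⟨_, trivial, rfl⟩)
    rw [mul_one] at h
    refine Submodule.span_mono ?_ h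
    rintro _ ⟨J, _, rfl⟩
    refine ⟨J, ?_, rfl⟩
    simpa using Set.ncard_le_card J
  | succ m ih =>
    rw [idealPow] at hr'
    refine Submodule.smul_induction_on hr' ?_ ?_
    · intro a ha b hb
      have hb2 := ih b hb
      rw [smul_eq_mul, Subalgebra.coe_mul]
      refine Submodule.span_induction (p := fun y _ => (a : MonoidAlgebra F W) * y ∈ _)
        ?_ ?_ ?_ ?_ hb2
      · rintro _ ⟨K, hK, rfl⟩
        refine Submodule.span_mono ?_ (SolB.jac_mul F cs K a ha)
        rintro _ ⟨L, hL, rfl⟩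
        refine ⟨L, ?_, rfl⟩
        have := Set.ncard_lt_ncard (Set.mem_Iio.1 hL) (Set.toFinite K)
        omega
      · simp
      · intro x y _ _ hx hy
        rw [mul_add]; exact Submodule.add_mem _ hx hy
      · intro c x _ hx
        rw [mul_smul_comm]; exact Submodule.smul_mem _ _ hx
    · intro x y hx hy
      rw [Subalgebra.coe_add]; exact Submodule.add_mem _ hx hy
end

section
/- Suppose the characteristic of F is 2, and let D = D_F(B_n) with Jacobson radical J(D). Then D/J(D) is one-dimensional over F (so D has a unique simple module up to isomorphism), and the F-dimension of J(D)/J(D)² is at least n. (Equivalently, the Ext-quiver of D_F(B_n) is a single vertex with at least n loops.) -/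
set_option maxHeartbeats 1000000
set_option synthInstance.maxHeartbeats 1000000

/-- The dimension over `F` of the quotient of a ring by a (left) ideal. -/
noncomputable def quotDim (F : Type*) [Field F] (R : Type*) [Ring R] [Algebra F R]
    (I : Ideal R) : ℕ :=
  Module.finrank F (R ⧸ I)

/-- The dimension over `F` of the quotient `I/K` of two (left) ideals of an `F`-algebra. -/
noncomputable def subquotDim (F : Type*) [Field F] (R : Type*) [Ring R] [Algebra F R]
    (I K : Ideal R) : ℕ :=
  Module.finrank F
    ((I.restrictScalars F) ⧸ Submodule.comap (I.restrictScalars F).subtype (K.restrictScalars F))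


namespace BDescent

/-- simple roots in standard coordinates -/
def rt {n : ℕ} (j : Fin n) : Fin n → ℤ :=
  fun k => if k = j then 1 else if k.val + 1 = j.val then -1 else 0

/-- simple coroots -/
def cort {n : ℕ} (j : Fin n) : (Fin n → ℤ) →ₗ[ℤ] ℤ where
  toFun x := if j.val = 0 then 2 * x j else x j - x ⟨j.val - 1, by omega⟩
  map_add' x y := by split_ifs <;> simp <;> ring
  map_smul' c x := by split_ifs <;> simp <;> ring

theorem cort_self {n : ℕ} (i : Fin n) : cort i (rt i) = 2 := by
  simp only [cort, rt, LinearMap.coe_mk, AddHom.coe_mk, Fin.ext_iff]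
  split_ifs <;> first | omega | rfl

theorem bcases {n : ℕ} (i j : Fin n) (h : i ≠ j) :
    ((BMat n) i j = 2 ∧ cort i (rt j) = 0 ∧ cort j (rt i) = 0) ∨
    ((BMat n) i j = 3 ∧ cort i (rt j) = -1 ∧ cort j (rt i) = -1) ∨
    ((BMat n) i j = 4 ∧ cort i (rt j) = -2 ∧ cort j (rt i) = -1) ∨
    ((BMat n) i j = 4 ∧ cort i (rt j) = -1 ∧ cort j (rt i) = -2) := by
  have hM : (BMat n) i j = if i = j then 1
    else if min (i : ℕ) (j : ℕ) = 0 ∧ max (i : ℕ) (j : ℕ) = 1 then 4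
    else if max (i : ℕ) (j : ℕ) = min (i : ℕ) (j : ℕ) + 1 then 3 else 2 := rfl
  rw [hM]
  simp only [cort, rt, LinearMap.coe_mk, AddHom.coe_mk, Fin.ext_iff]
  have h' : i.val ≠ j.val := fun hh => h (Fin.ext hh)
  rcases lt_trichotomy i.val j.val with hl | hl | hl
  · rw [min_eq_left hl.le, max_eq_right hl.le]
    split_ifs <;> first | omega | simp
  · omega
  · rw [min_eq_right hl.le, max_eq_left hl.le]
    split_ifs <;> first | omega | simp

/-- simple reflections -/
def sig {n : ℕ} (i : Fin n) : Module.End ℤ (Fin n → ℤ) :=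
  LinearMap.id - (cort i).smulRight (rt i)

theorem sig_apply {n : ℕ} (i : Fin n) (x : Fin n → ℤ) :
    sig i x = x - cort i x • rt i := by simp [sig]

theorem sig_liftable (n : ℕ) : (BMat n).IsLiftable (sig (n := n)) := by
  intro i j
  have hi := cort_self i
  have hj := cort_self j
  by_cases h : i = j
  · subst h
    rw [(BMat n).diagonal, pow_one]
    refine LinearMap.ext fun x => ?_
    simp only [Module.End.mul_apply, Module.End.one_apply, sig_apply, map_sub, map_smul, hi,
      smul_eq_mul]
    module
  · rcases bcases i j h with ⟨hm, h1, h2⟩ | ⟨hm, h1, h2⟩ | ⟨hm, h1, h2⟩ | ⟨hm, h1, h2⟩ <;>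
    · rw [hm]
      refine LinearMap.ext fun x => ?_
      simp only [pow_succ, pow_zero, one_mul, Module.End.mul_apply, Module.End.one_apply,
        sig_apply, map_sub, map_smul, hi, hj, h1, h2, smul_eq_mul]
      module

/-- fundamental coweights -/
def lam {n : ℕ} (i : Fin n) : (Fin n → ℤ) →ₗ[ℤ] ℤ :=
  ∑ k, if i ≤ k then LinearMap.proj k else 0

theorem lam_apply {n : ℕ} (i : Fin n) (x : Fin n → ℤ) :
    lam i x = ∑ k, if i ≤ k then x k else 0 := by
  simp only [lam, LinearMap.sum_apply]
  refine Finset.sum_congr rfl fun k _ => ?_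
  split_ifs <;> simp

theorem rt_zero {n : ℕ} (j : Fin n) (h : j.val = 0) : rt j = Pi.single j 1 := by
  funext k
  simp only [rt, Pi.single_apply]
  split_ifs <;> first | omega | rfl

theorem rt_succ {n : ℕ} (j k : Fin n) (h : k.val + 1 = j.val) :
    rt j = Pi.single j 1 - Pi.single k 1 := by
  funext l
  simp only [rt, Pi.single_apply, Pi.sub_apply, Fin.ext_iff]
  split_ifs <;> first | omega | rfl

theorem lam_single {n : ℕ} (i j : Fin n) :
    lam i (Pi.single j 1) = if i ≤ j then 1 else 0 := by
  rw [lam_apply, Finset.sum_eq_single j]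
  · simp
  · intro b _ hb
    simp [hb]
  · simp

theorem lam_rt {n : ℕ} (i j : Fin n) : lam i (rt j) = if i = j then 1 else 0 := by
  rcases Nat.eq_zero_or_pos j.val with h | h
  · rw [rt_zero j h, lam_single]
    simp only [Fin.le_def, Fin.ext_iff]
    split_ifs <;> first | omega | rfl
  · rw [rt_succ j ⟨j.val - 1, by omega⟩ (by simp; omega), map_sub, lam_single, lam_single]
    simp only [Fin.le_def, Fin.ext_iff]
    split_ifs <;> first | omega | rfl

theorem expand_single {n : ℕ} (m : ℕ) (hm : m < n) :
    ∑ i, lam i (Pi.single ⟨m, hm⟩ 1) • rt i = (Pi.single ⟨m, hm⟩ 1 : Fin n → ℤ) := by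
  have key : ∀ j : Fin n, ∑ i, lam i (rt j) • rt i = rt j := by
    intro j
    simp [lam_rt]
  induction m with
  | zero =>
    have := key ⟨0, hm⟩
    rwa [rt_zero _ rfl] at this
  | succ m ih =>
    have h1 := key ⟨m + 1, hm⟩
    have h2 := ih (by omega)
    rw [rt_succ ⟨m + 1, hm⟩ ⟨m, by omega⟩ rfl] at h1
    simp only [map_sub, sub_smul, Finset.sum_sub_distrib] at h1
    rw [h2] at h1
    exact sub_left_inj.mp h1

theorem expand {n : ℕ} (x : Fin n → ℤ) : ∑ i, lam i x • rt i = x := by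
  have : (∑ i, (lam i).smulRight (rt i) : Module.End ℤ (Fin n → ℤ)) = LinearMap.id := by
    refine LinearMap.pi_ext' fun k => LinearMap.ext_ring ?_
    have := expand_single k.val k.isLt
    simpa [LinearMap.sum_apply] using this
  have h := congrArg (fun f => f x) this
  simpa [LinearMap.sum_apply] using h

/-- nonnegative vectors in the root lattice -/
def Pos {n : ℕ} (x : Fin n → ℤ) : Prop := ∀ i, 0 ≤ lam i x

theorem Pos.comb {n : ℕ} {x y : Fin n → ℤ} (hx : Pos x) (hy : Pos y) (a b : ℤ) (ha : 0 ≤ a)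
    (hb : 0 ≤ b) : Pos (a • x + b • y) := by
  intro i
  simp only [map_add, map_smul, smul_eq_mul]
  have := hx i
  have := hy i
  positivity

theorem eq_zero_of_pos {n : ℕ} {x : Fin n → ℤ} (hx : Pos x) (hy : Pos (-x)) : x = 0 := by
  rw [← expand x]
  refine Finset.sum_eq_zero fun i _ => ?_
  have h1 := hx i
  have h2 := hy i
  rw [map_neg] at h2
  rw [show lam i x = 0 by omega, zero_smul]

section
variable {n : ℕ} {W : Type*} [Group W] (cs : CoxeterSystem (BMat n) W)

/-- the reflection representation -/
noncomputable def rep : W →* Module.End ℤ (Fin n → ℤ) := cs.lift ⟨sig, sig_liftable n⟩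

theorem rep_simple (i : Fin n) : rep cs (cs.simple i) = sig i := cs.lift_apply_simple _ i

theorem rep_mul_simple (w : W) (i : Fin n) (x : Fin n → ℤ) :
    rep cs (w * cs.simple i) x = rep cs w x - cort i x • rep cs w (rt i) := by
  rw [map_mul, Module.End.mul_apply, rep_simple, sig_apply, map_sub, map_smul]

/-- right ascents -/
def Asc (w : W) (i : Fin n) : Prop := cs.length w < cs.length (w * cs.simple i)

theorem not_asc {w : W} {i : Fin n} (h : ¬ Asc cs w i) :
    cs.length (w * cs.simple i) + 1 = cs.length w := by
  unfold Asc at h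
  rcases cs.length_mul_simple w i with h1 | h1 <;> omega

theorem asc_or {w : W} {i : Fin n} (h : ¬ Asc cs w i) : ∃ v, w = v * cs.simple i ∧
    cs.length v + 1 = cs.length w ∧ Asc cs v i := by
  refine ⟨w * cs.simple i, by simp, not_asc cs h, ?_⟩
  have := not_asc cs h
  simp only [Asc, cs.simple_mul_simple_cancel_right]
  omega

theorem len_le {w v : W} {i : Fin n} (h : Asc cs w i) (hv : w * cs.simple i = v) :
    cs.length w < cs.length v := by
  subst hv; exact h

theorem tits_aux (N : ℕ) : ∀ w : W, cs.length w = N → ∀ i, Asc cs w i → Pos (rep cs w (rt i)) := by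
  induction N using Nat.strong_induction_on with
  | _ N IH =>
  intro w hw s hs
  have IH' : ∀ v : W, cs.length v < N → ∀ i, Asc cs v i → Pos (rep cs v (rt i)) :=
    fun v hv i hi => IH _ hv v rfl i hi
  by_cases hone : w = 1
  · subst hone
    intro j
    rw [map_one, Module.End.one_apply, lam_rt]
    split_ifs <;> simp
  obtain ⟨t, ht⟩ := cs.exists_rightDescent_of_ne_one hone
  have ht' : ¬ Asc cs w t := by
    unfold Asc; unfold CoxeterSystem.IsRightDescent at ht; omega
  have hst : s ≠ t := by rintro rfl; exact ht' hs
  have hss := cort_self s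
  have htt := cort_self t
  have hpow := cs.simple_mul_simple_pow s t
  have ss := cs.simple_mul_simple_self s
  have tt := cs.simple_mul_simple_self t
  obtain ⟨w1, e1, l1, a1⟩ := asc_or cs ht'
  by_cases b1 : Asc cs w1 s
  · have p1 := IH' w1 (by omega) s b1
    have p2 := IH' w1 (by omega) t a1
    rw [e1, rep_mul_simple]
    rcases bcases s t hst with ⟨hm, h1, h2⟩ | ⟨hm, h1, h2⟩ | ⟨hm, h1, h2⟩ | ⟨hm, h1, h2⟩
    · rw [h2]; convert p1.comb p2 1 0 (by simp) (by simp) using 1; module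
    · rw [h2]; convert p1.comb p2 1 1 (by simp) (by simp) using 1; module
    · rw [h2]; convert p1.comb p2 1 1 (by simp) (by simp) using 1; module
    · rw [h2]; convert p1.comb p2 1 2 (by simp) (by simp) using 1; module
  obtain ⟨w2, e2, l2, a2⟩ := asc_or cs b1
  have ge2 : ¬ (BMat n) s t = 2 := by
    intro hm
    rw [hm, pow_two] at hpow
    have hc : w * cs.simple s = w2 * cs.simple t := by
      rw [e1, e2]
      have : cs.simple s * cs.simple t * cs.simple s = cs.simple t := by
        rw [← mul_inv_eq_one, cs.inv_simple]; simpa [mul_assoc] using hpow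
      simp only [mul_assoc] at this ⊢
      rw [this]
    have := cs.length_mul_le w2 (cs.simple t)
    rw [cs.length_simple, ← hc] at this
    unfold Asc at hs
    omega
  by_cases b2 : Asc cs w2 t
  · have p1 := IH' w2 (by omega) s a2
    have p2 := IH' w2 (by omega) t b2
    rw [e1, e2, rep_mul_simple, rep_mul_simple, rep_mul_simple, hss]
    rcases bcases s t hst with ⟨hm, h1, h2⟩ | ⟨hm, h1, h2⟩ | ⟨hm, h1, h2⟩ | ⟨hm, h1, h2⟩
    · exact absurd hm ge2
    · rw [h2, h1]; convert p1.comb p2 0 1 (by simp) (by simp) using 1; module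
    · rw [h2, h1]; convert p1.comb p2 1 1 (by simp) (by simp) using 1; module
    · rw [h2, h1]; convert p1.comb p2 1 2 (by simp) (by simp) using 1; module
  obtain ⟨w3, e3, l3, a3⟩ := asc_or cs b2
  have ge3 : ¬ (BMat n) s t = 3 := by
    intro hm
    rw [hm, pow_three] at hpow
    have hc : w * cs.simple s = w3 * cs.simple s * cs.simple t := by
      rw [e1, e2, e3]
      have : cs.simple t * cs.simple s * cs.simple t * cs.simple s = cs.simple s * cs.simple t := by
        calc _ = cs.simple s * (cs.simple s * cs.simple t * (cs.simple s * cs.simple t *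
              (cs.simple s * cs.simple t))) * cs.simple t := by simp [mul_assoc]
          _ = _ := by rw [hpow]; simp
      simp only [mul_assoc] at this ⊢
      rw [this]
    have h5 := cs.length_mul_le (w3 * cs.simple s) (cs.simple t)
    have h6 := cs.length_mul_le w3 (cs.simple s)
    rw [cs.length_simple] at h5 h6
    rw [← hc] at h5
    unfold Asc at hs
    omega
  by_cases b3 : Asc cs w3 s
  · have p1 := IH' w3 (by omega) s b3
    have p2 := IH' w3 (by omega) t a3
    rw [e1, e2, e3]
    simp only [rep_mul_simple, hss, htt]
    rcases bcases s t hst with ⟨hm, h1, h2⟩ | ⟨hm, h1, h2⟩ | ⟨hm, h1, h2⟩ | ⟨hm, h1, h2⟩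
    · exact absurd hm ge2
    · exact absurd hm ge3
    · rw [h2, h1]; convert p1.comb p2 1 0 (by simp) (by simp) using 1; module
    · rw [h2, h1]; convert p1.comb p2 1 0 (by simp) (by simp) using 1; module
  obtain ⟨w4, e4, l4, a4⟩ := asc_or cs b3
  have hm : (BMat n) s t = 4 := by
    rcases bcases s t hst with ⟨hm, -⟩ | ⟨hm, -⟩ | ⟨hm, -⟩ | ⟨hm, -⟩
    · exact absurd hm ge2
    · exact absurd hm ge3
    · exact hm
    · exact hm
  exfalso
  rw [hm] at hpow
  have hc : w * cs.simple s = w4 * cs.simple t * cs.simple s * cs.simple t := by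
    rw [e1, e2, e3, e4]
    calc _ = w4 * (cs.simple s * cs.simple t) ^ 4 * cs.simple t * cs.simple s * cs.simple t := by
          simp [mul_assoc, pow_succ]
      _ = _ := by rw [hpow]; simp
  have h5 := cs.length_mul_le (w4 * cs.simple t * cs.simple s) (cs.simple t)
  have h6 := cs.length_mul_le (w4 * cs.simple t) (cs.simple s)
  have h7 := cs.length_mul_le w4 (cs.simple t)
  rw [cs.length_simple] at h5 h6 h7
  rw [← hc] at h5
  unfold Asc at hs
  omega

end
end BDescent

namespace BDescent

section
variable {n : ℕ} {W : Type*} [Group W] (cs : CoxeterSystem (BMat n) W)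

theorem asc_pos {w : W} {i : Fin n} (h : Asc cs w i) : Pos (rep cs w (rt i)) :=
  tits_aux cs _ w rfl i h

theorem not_asc_neg {w : W} {i : Fin n} (h : ¬ Asc cs w i) : Pos (-rep cs w (rt i)) := by
  obtain ⟨v, hv, -, ha⟩ := asc_or cs h
  have := asc_pos cs ha
  rw [hv, rep_mul_simple, cort_self]
  convert this using 1
  module

theorem rep_inv_apply (w : W) (x : Fin n → ℤ) : rep cs w⁻¹ (rep cs w x) = x := by
  rw [← Module.End.mul_apply, ← map_mul]; simp

theorem rep_rt_ne (w : W) (i : Fin n) : rep cs w (rt i) ≠ 0 := by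
  intro h
  have h1 := rep_inv_apply cs w (rt i)
  rw [h, map_zero] at h1
  have := lam_rt i i
  rw [← h1] at this
  simp at this

theorem asc_of_pos {w : W} {i : Fin n} (h : Pos (rep cs w (rt i))) : Asc cs w i := by
  by_contra hc
  exact rep_rt_ne cs w i (eq_zero_of_pos h (not_asc_neg cs hc))

theorem not_asc_of_neg {w : W} {i : Fin n} (h : Pos (-rep cs w (rt i))) : ¬ Asc cs w i := by
  intro hc
  exact rep_rt_ne cs w i (eq_zero_of_pos (asc_pos cs hc) h)

open Classical in
/-- the functional vanishing exactly on the simple roots in `J` -/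
noncomputable def lamS (J : Set (Fin n)) : (Fin n → ℤ) →ₗ[ℤ] ℤ :=
  ∑ i, if i ∈ J then 0 else lam i

open Classical in
theorem lamS_apply (J : Set (Fin n)) (x : Fin n → ℤ) :
    lamS J x = ∑ i, if i ∈ J then 0 else lam i x := by
  simp only [lamS, LinearMap.sum_apply]
  refine Finset.sum_congr rfl fun k _ => ?_
  split_ifs <;> simp

open Classical in
theorem lamS_rt (J : Set (Fin n)) (j : Fin n) : lamS J (rt j) = if j ∈ J then 0 else 1 := by
  rw [lamS_apply, Finset.sum_eq_single j]
  · simp [lam_rt]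
  · intro b _ hb
    simp [lam_rt, hb]
  · simp

theorem lamS_nonneg (J : Set (Fin n)) {x : Fin n → ℤ} (hx : Pos x) : 0 ≤ lamS J x := by
  classical
  rw [lamS_apply]
  refine Finset.sum_nonneg fun i _ => ?_
  split_ifs
  · exact le_rfl
  · exact hx i

theorem lamS_zero (J : Set (Fin n)) {x : Fin n → ℤ} (hx : Pos x) (h0 : lamS J x = 0) :
    ∀ i, i ∉ J → lam i x = 0 := by
  classical
  rw [lamS_apply, Finset.sum_eq_zero_iff_of_nonneg] at h0
  · intro i hi
    simpa [hi] using h0 i (Finset.mem_univ i)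
  · intro i _
    split_ifs
    · exact le_rfl
    · exact hx i

/-- the set `X_J` -/
def XS (J : Set (Fin n)) : Set W := {w | ∀ i ∈ J, Asc cs w i}

theorem XS_pos {J : Set (Fin n)} {u : W} (hu : u ∈ XS cs J) {x : Fin n → ℤ} (hx : Pos x)
    (h0 : lamS J x = 0) : Pos (rep cs u x) := by
  have hz := lamS_zero J hx h0
  intro k
  rw [← expand x, map_sum, map_sum]
  refine Finset.sum_nonneg fun i _ => ?_
  rw [map_smul, map_smul, smul_eq_mul]
  by_cases hi : i ∈ J
  · exact mul_nonneg (hx i) (asc_pos cs (hu i hi) k)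
  · rw [hz i hi, zero_mul]

theorem XS_asc {J : Set (Fin n)} {u : W} (hu : u ∈ XS cs J) (v : W) (k : Fin n)
    (h0 : lamS J (rep cs v (rt k)) = 0) : Asc cs v k ↔ Asc cs (u * v) k := by
  constructor
  · intro h
    apply asc_of_pos
    rw [map_mul, Module.End.mul_apply]
    exact XS_pos cs hu (asc_pos cs h) h0
  · intro h
    by_contra hc
    refine not_asc_of_neg cs ?_ h
    rw [map_mul, Module.End.mul_apply, ← map_neg]
    exact XS_pos cs hu (not_asc_neg cs hc) (by rw [map_neg, h0, neg_zero])

theorem XS_cond {J K : Set (Fin n)} {u v w : W} (hu : u ∈ XS cs J) (hw : u * v = w) :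
    v ∈ XS cs K ↔ ∀ k ∈ K, 0 < lamS J (rep cs v (rt k)) ∨
      (lamS J (rep cs v (rt k)) = 0 ∧ Asc cs w k) := by
  refine forall₂_congr fun k _ => ?_
  rcases lt_trichotomy (lamS J (rep cs v (rt k))) 0 with h | h | h
  · have : ¬ Asc cs v k := fun hc => by
      have := lamS_nonneg J (asc_pos cs hc)
      omega
    simp only [this, false_iff]
    omega
  · rw [XS_asc cs hu v k h, hw]
    simp [h]
  · have : Asc cs v k := by
      by_contra hc
      have := lamS_nonneg J (not_asc_neg cs hc)
      rw [map_neg] at this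
      omega
    simp [this, h]

theorem lamS_simple (J : Set (Fin n)) {j : Fin n} (hj : j ∈ J) :
    lamS J ∘ₗ rep cs (cs.simple j) = lamS J := by
  classical
  refine LinearMap.ext fun x => ?_
  rw [LinearMap.comp_apply, rep_simple, sig_apply, map_sub, map_smul, lamS_rt, if_pos hj]
  simp

theorem lamS_comp_mul (J : Set (Fin n)) (u v : W) :
    lamS J ∘ₗ rep cs (u * v) = (lamS J ∘ₗ rep cs u) ∘ₗ rep cs v := by
  rw [map_mul]; rfl

theorem lamS_cancel (J : Set (Fin n)) (u v w : W)
    (h : lamS J ∘ₗ rep cs (u * w) = lamS J ∘ₗ rep cs (v * w)) :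
    lamS J ∘ₗ rep cs u = lamS J ∘ₗ rep cs v := by
  have := congrArg (fun f => f ∘ₗ rep cs w⁻¹) h
  simp only [← lamS_comp_mul] at this
  simpa using this

theorem all_asc {w : W} (h : ∀ i, Asc cs w i) : w = 1 := by
  by_contra hc
  obtain ⟨i, hi⟩ := cs.exists_rightDescent_of_ne_one hc
  have := h i
  unfold Asc at this
  unfold CoxeterSystem.IsRightDescent at hi
  omega

theorem XS_inj {J : Set (Fin n)} {u u' : W} (hu : u ∈ XS cs J) (hu' : u' ∈ XS cs J)
    (h : lamS J ∘ₗ rep cs u⁻¹ = lamS J ∘ₗ rep cs u'⁻¹) : u = u' := by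
  classical
  have hz : lamS J ∘ₗ rep cs (u⁻¹ * u') = lamS J := by
    rw [lamS_comp_mul, h, ← lamS_comp_mul]
    simp
    rfl
  have : u⁻¹ * u' = 1 := by
    apply all_asc cs
    intro i
    by_contra hc
    have h1 := lamS_nonneg J (not_asc_neg cs hc)
    have h2 : lamS J (rep cs (u⁻¹ * u') (rt i)) = lamS J (rt i) :=
      congrArg (fun f => f (rt i)) hz
    have h3 := lamS_rt J i
    rw [map_neg] at h1
    have hi : i ∈ J := by
      by_contra hi
      rw [if_neg hi] at h3
      omega
    rw [if_pos hi] at h3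
    have := (XS_asc cs hu (u⁻¹ * u') i (by omega)).2
    rw [mul_inv_cancel_left] at this
    exact hc (this (hu' i hi))
  exact (inv_mul_eq_one.mp this)

theorem XS_surj (J : Set (Fin n)) (h : W) : ∃ u ∈ XS cs J,
    lamS J ∘ₗ rep cs u⁻¹ = lamS J ∘ₗ rep cs h⁻¹ := by
  classical
  have hex : ∃ m, ∃ u, cs.length u = m ∧ lamS J ∘ₗ rep cs u⁻¹ = lamS J ∘ₗ rep cs h⁻¹ :=
    ⟨_, h, rfl, rfl⟩
  obtain ⟨u, hu, hl⟩ := Nat.find_spec hex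
  refine ⟨u, ?_, hl⟩
  intro j hj
  by_contra hc
  have hlt := not_asc cs hc
  refine Nat.find_min hex (m := cs.length (u * cs.simple j)) (by omega) ⟨_, rfl, ?_⟩
  rw [mul_inv_rev, lamS_comp_mul, cs.inv_simple, lamS_simple cs J hj, hl]

theorem exists_des [Finite W] (T : Set (Fin n)) : ∃ w : W, ∀ i, Asc cs w i ↔ i ∉ T := by
  classical
  obtain ⟨w, hw, hmax⟩ := Set.exists_max_image {w : W | lamS T ∘ₗ rep cs w = lamS T} cs.length
    (Set.toFinite _) ⟨1, by simp; rfl⟩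
  refine ⟨w, fun i => ⟨fun h hi => ?_, fun hi => ?_⟩⟩
  · have := hmax (w * cs.simple i) (by
      simp only [Set.mem_setOf_eq] at hw ⊢
      rw [lamS_comp_mul, hw, lamS_simple cs T hi])
    unfold Asc at h
    omega
  · by_contra hc
    have h1 := lamS_nonneg T (not_asc_neg cs hc)
    have h2 : lamS T (rep cs w (rt i)) = lamS T (rt i) :=
      congrArg (fun f => f (rt i)) hw
    have h3 := lamS_rt T i
    rw [if_neg hi] at h3
    rw [map_neg] at h1
    omega

theorem exists_flip (m : ℕ) (hm : m < n) :
    ∃ w : W, ∀ x, rep cs w x = x - (2 * x ⟨m, hm⟩) • Pi.single ⟨m, hm⟩ 1 := by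
  induction m with
  | zero =>
    refine ⟨cs.simple ⟨0, hm⟩, fun x => ?_⟩
    rw [rep_simple, sig_apply, rt_zero _ rfl]
    rfl
  | succ m ih =>
    obtain ⟨w, hw⟩ := ih (by omega)
    refine ⟨cs.simple ⟨m + 1, hm⟩ * w * cs.simple ⟨m + 1, hm⟩, fun x => ?_⟩
    simp only [map_mul, Module.End.mul_apply, hw, rep_simple, sig_apply]
    rw [rt_succ ⟨m + 1, hm⟩ ⟨m, by omega⟩ rfl]
    have hc : ∀ y, cort ⟨m + 1, hm⟩ y = y ⟨m + 1, hm⟩ - y ⟨m, by omega⟩ := fun y => rfl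
    funext k
    simp only [hc, Pi.sub_apply, Pi.smul_apply, Pi.single_apply, Fin.ext_iff, smul_eq_mul]
    split_ifs <;> first | omega | (simp; try ring)

theorem exists_neg : ∃ w : W, ∀ x, rep cs w x = -x := by
  have key : ∀ T : Finset (Fin n), ∃ w : W, ∀ x k, rep cs w x k = if k ∈ T then -x k else x k := by
    intro T
    induction T using Finset.induction_on with
    | empty => exact ⟨1, fun x k => by simp⟩
    | insert a T ha ih =>
      obtain ⟨w, hw⟩ := ih
      obtain ⟨v, hv⟩ := exists_flip cs a.val a.isLt
      refine ⟨v * w, fun x k => ?_⟩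
      simp only [map_mul, Module.End.mul_apply, hv, Fin.eta, Pi.sub_apply, Pi.smul_apply,
        Pi.single_apply, hw, Finset.mem_insert, smul_eq_mul]
      by_cases hk : k = a
      · subst hk
        simp [ha]
        ring
      · simp [hk]
  obtain ⟨w, hw⟩ := key Finset.univ
  exact ⟨w, fun x => funext fun k => by simpa using hw x k⟩

end
end BDescent

namespace BDescent

section
variable {n : ℕ} {W : Type*} [Group W] [Fintype W] (cs : CoxeterSystem (BMat n) W)

open Classical in
/-- the orbit of `lamS J` -/
noncomputable def Orb (J : Set (Fin n)) : Finset ((Fin n → ℤ) →ₗ[ℤ] ℤ) :=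
  Finset.univ.image fun g : W => lamS J ∘ₗ rep cs g

open Classical in
/-- structure constants -/
noncomputable def acoef (J K L : Set (Fin n)) : ℕ :=
  ((Orb cs J).filter fun f => (∀ k ∈ K, 0 ≤ f (rt k)) ∧ L = {k | k ∈ K ∧ f (rt k) = 0}).card

open Classical in
theorem count1 (J K : Set (Fin n)) (w : W) :
    (Finset.univ.filter fun u : W => u ∈ XS cs J ∧ u⁻¹ * w ∈ XS cs K).card =
    ((Orb cs J).filter fun f => ∀ k ∈ K, 0 < f (rt k) ∨ (f (rt k) = 0 ∧ Asc cs w k)).card := by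
  refine Finset.card_bij (fun u _ => lamS J ∘ₗ rep cs (u⁻¹ * w)) ?_ ?_ ?_
  · intro u hu
    simp only [Finset.mem_filter, Finset.mem_univ, true_and] at hu
    simp only [Finset.mem_filter, Orb, Finset.mem_image, Finset.mem_univ, true_and]
    exact ⟨⟨_, rfl⟩, (XS_cond cs hu.1 (by simp)).1 hu.2⟩
  · intro u hu u' hu' h
    simp only [Finset.mem_filter, Finset.mem_univ, true_and] at hu hu'
    exact XS_inj cs hu.1 hu'.1 (lamS_cancel cs J _ _ _ h)
  · intro f hf
    simp only [Finset.mem_filter, Orb, Finset.mem_image, Finset.mem_univ, true_and] at hf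
    obtain ⟨⟨g, rfl⟩, hf⟩ := hf
    obtain ⟨u, hu, he⟩ := XS_surj cs J (w * g⁻¹)
    have he' : lamS J ∘ₗ rep cs (u⁻¹ * w) = lamS J ∘ₗ rep cs g := by
      rw [lamS_comp_mul, he, ← lamS_comp_mul]
      simp
    refine ⟨u, ?_, he'⟩
    simp only [Finset.mem_filter, Finset.mem_univ, true_and]
    refine ⟨hu, (XS_cond cs hu (v := u⁻¹ * w) (w := w) (by simp)).2 ?_⟩
    rw [← he'] at hf
    exact hf

open Classical in
theorem count2 (J K : Set (Fin n)) (w : W) :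
    ((Orb cs J).filter fun f => ∀ k ∈ K, 0 < f (rt k) ∨ (f (rt k) = 0 ∧ Asc cs w k)).card =
    ∑ L : Set (Fin n), if w ∈ XS cs L then acoef cs J K L else 0 := by
  simp only [acoef, Finset.card_filter]
  have : ∀ L : Set (Fin n), (if w ∈ XS cs L then ∑ f ∈ Orb cs J,
      (if (∀ k ∈ K, 0 ≤ f (rt k)) ∧ L = {k | k ∈ K ∧ f (rt k) = 0} then 1 else 0) else 0) =
      ∑ f ∈ Orb cs J, if L = {k | k ∈ K ∧ f (rt k) = 0} then
        (if (∀ k ∈ K, 0 ≤ f (rt k)) ∧ w ∈ XS cs {k | k ∈ K ∧ f (rt k) = 0} then 1 else 0) else 0 := by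
    intro L
    by_cases hw : w ∈ XS cs L
    · rw [if_pos hw]
      refine Finset.sum_congr rfl fun f _ => ?_
      by_cases hL : L = {k | k ∈ K ∧ f (rt k) = 0}
      · rw [← hL]; simp [hw]
      · simp [hL]
    · rw [if_neg hw]
      symm
      refine Finset.sum_eq_zero fun f _ => ?_
      by_cases hL : L = {k | k ∈ K ∧ f (rt k) = 0}
      · rw [← hL]; simp [hw]
      · simp [hL]
  simp only [this]
  rw [Finset.sum_comm]
  refine Finset.sum_congr rfl fun f _ => ?_
  rw [Finset.sum_ite_eq' Finset.univ, if_pos (Finset.mem_univ _)]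
  congr 1
  apply propext
  constructor
  · intro h
    refine ⟨fun k hk => ?_, fun k hk => ?_⟩
    · have := h k hk
      omega
    · have h1 := h k hk.1
      have h2 : f (rt k) = 0 := hk.2
      rcases h1 with h1 | h1
      · omega
      · exact h1.2
  · rintro ⟨h1, h2⟩ k hk
    rcases (h1 k hk).lt_or_eq with h | h
    · exact Or.inl h
    · exact Or.inr ⟨h.symm, h2 k ⟨hk, h.symm⟩⟩

theorem acoef_sub {J K L : Set (Fin n)} (h : ¬ L ⊆ K) : acoef cs J K L = 0 := by
  classical
  rw [acoef, Finset.card_eq_zero, Finset.filter_eq_empty_iff]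
  rintro f - ⟨-, rfl⟩
  exact h fun k hk => hk.1

theorem acoef_even {J : Set (Fin n)} (hJ : J ≠ Set.univ) (K : Set (Fin n)) :
    Even (acoef cs J K K) := by
  classical
  obtain ⟨w0, hw0⟩ := exists_neg cs
  rw [acoef]
  have hz : (((Orb cs J).filter fun f => (∀ k ∈ K, 0 ≤ f (rt k)) ∧
      K = {k | k ∈ K ∧ f (rt k) = 0}).card : ZMod 2) = 0 := by
    rw [Finset.card_eq_sum_ones, Nat.cast_sum]
    refine Finset.sum_involution (fun f _ => -f) ?_ ?_ ?_ ?_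
    · intro f _
      decide
    · intro f hf _ he
      simp only [Finset.mem_filter, Orb, Finset.mem_image, Finset.mem_univ, true_and] at hf
      obtain ⟨⟨g, rfl⟩, -⟩ := hf
      obtain ⟨i, hi⟩ := (Set.ne_univ_iff_exists_notMem J).1 hJ
      have h1 := congrArg (fun f => f (rep cs g⁻¹ (rt i))) he
      have h2 : rep cs g (rep cs g⁻¹ (rt i)) = rt i := by
        simpa using rep_inv_apply cs g⁻¹ (rt i)
      simp only [LinearMap.neg_apply, LinearMap.comp_apply, h2, lamS_rt, if_neg hi] at h1
      omega
    · intro f hf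
      simp only [Finset.mem_filter, Orb, Finset.mem_image, Finset.mem_univ, true_and] at hf ⊢
      obtain ⟨⟨g, rfl⟩, -, hK⟩ := hf
      have hk0 : ∀ k ∈ K, (lamS J ∘ₗ rep cs g) (rt k) = 0 := by
        intro k hk
        rw [hK] at hk
        exact hk.2
      refine ⟨⟨g * w0, ?_⟩, ?_, ?_⟩
      · refine LinearMap.ext fun x => ?_
        simp [map_mul, Module.End.mul_apply, hw0]
      · intro k hk
        rw [LinearMap.neg_apply, hk0 k hk, neg_zero]
      · ext k
        refine ⟨fun hk => ⟨hk, ?_⟩, fun hk => hk.1⟩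
        rw [LinearMap.neg_apply, hk0 k hk, neg_zero]
    · intro f _
      exact neg_neg f
  exact (ZMod.natCast_eq_zero_iff_even).1 hz

variable (F : Type*) [Field F]

open Classical in
theorem descentElt_eq (J : Set (Fin n)) : descentElt F cs J =
    ∑ w : W, if w ∈ XS cs J then MonoidAlgebra.of F W w else 0 := by
  unfold descentElt
  refine Finset.sum_congr rfl fun w _ => ?_
  congr 1

theorem mul_formula (J K : Set (Fin n)) : descentElt F cs J * descentElt F cs K =
    ∑ L : Set (Fin n), (acoef cs J K L : F) • descentElt F cs L := by
  classical
  have h1 : descentElt F cs J * descentElt F cs K =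
      ∑ w : W, (((Finset.univ.filter fun u : W => u ∈ XS cs J ∧ u⁻¹ * w ∈ XS cs K).card : ℕ) : F) •
        MonoidAlgebra.of F W w := by
    rw [descentElt_eq, descentElt_eq, Finset.sum_mul_sum]
    simp only [Finset.card_filter, Nat.cast_sum, Finset.sum_smul]
    rw [Finset.sum_comm (s := (Finset.univ : Finset W)) (t := (Finset.univ : Finset W))
      (f := fun w u => ((if u ∈ XS cs J ∧ u⁻¹ * w ∈ XS cs K then 1 else 0 : ℕ) : F) •
        MonoidAlgebra.of F W w)]
    refine Finset.sum_congr rfl fun u _ => ?_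
    refine Eq.trans ?_ (Equiv.sum_comp (Equiv.mulLeft u) _)
    refine Finset.sum_congr rfl fun v _ => ?_
    simp only [Equiv.coe_mulLeft, inv_mul_cancel_left]
    by_cases hu : u ∈ XS cs J <;> by_cases hv : v ∈ XS cs K <;> simp [hu, hv]
  rw [h1]
  simp only [count1, count2, descentElt_eq, Finset.smul_sum]
  rw [Finset.sum_comm]
  refine Finset.sum_congr rfl fun w _ => ?_
  rw [Nat.cast_sum, Finset.sum_smul]
  refine Finset.sum_congr rfl fun L _ => ?_
  split_ifs <;> simp

theorem mul_mem (hchar : ringChar F = 2) {J : Set (Fin n)} (hJ : J ≠ Set.univ) (K : Set (Fin n)) :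
    descentElt F cs J * descentElt F cs K ∈
      Submodule.span F (descentElt F cs '' {L | L ⊂ K}) := by
  rw [mul_formula]
  refine Submodule.sum_mem _ fun L _ => ?_
  by_cases hL : L ⊂ K
  · exact Submodule.smul_mem _ _ (Submodule.subset_span ⟨L, hL, rfl⟩)
  · have : (acoef cs J K L : F) = 0 := by
      by_cases hs : L ⊆ K
      · have : L = K := by
          by_contra hne
          exact hL (lt_of_le_of_ne hs hne)
        subst this
        rw [ringChar.spec, hchar]
        exact (acoef_even cs hJ L).two_dvd
      · rw [acoef_sub cs hs, Nat.cast_zero]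
    rw [this, zero_smul]
    exact Submodule.zero_mem _

theorem descentElt_univ : descentElt F cs Set.univ = 1 := by
  classical
  rw [descentElt_eq, Finset.sum_eq_single 1]
  · rw [if_pos, map_one]
    intro i _
    simp [Asc]
  · intro w _ hw
    rw [if_neg]
    intro h
    exact hw (all_asc cs fun i => h i trivial)
  · simp

theorem linInd : LinearIndependent F (descentElt F cs) := by
  classical
  rw [Fintype.linearIndependent_iff]
  intro g hg
  have key : ∀ w : W, ∑ L : Set (Fin n), (if w ∈ XS cs L then g L else 0) = 0 := by
    have h2 : ∑ w : W, (∑ L : Set (Fin n), (if w ∈ XS cs L then g L else 0)) •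
        MonoidAlgebra.of F W w = 0 := by
      rw [← hg]
      simp only [Finset.sum_smul, descentElt_eq, Finset.smul_sum]
      rw [Finset.sum_comm]
      refine Finset.sum_congr rfl fun L _ => Finset.sum_congr rfl fun w _ => ?_
      split_ifs <;> simp
    have hli : LinearIndependent F (fun w : W => MonoidAlgebra.of F W w) := by
      convert (MonoidAlgebra.basis W F).linearIndependent using 1
      ext w : 1
      simp
    exact Fintype.linearIndependent_iff.1 hli _ h2
  by_contra hne
  push Not at hne
  obtain ⟨L0, hL0⟩ := hne
  obtain ⟨L, hL, hmin⟩ := Set.exists_min_image {L : Set (Fin n) | g L ≠ 0} Set.ncard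
    (Set.toFinite _) ⟨L0, hL0⟩
  obtain ⟨w, hw⟩ := exists_des cs Lᶜ
  have := key w
  rw [Finset.sum_eq_single L] at this
  · rw [if_pos] at this
    · exact hL this
    · intro i hi
      exact (hw i).2 (by simpa using hi)
  · intro L' _ hne
    split_ifs with h
    · by_contra hg'
      have h1 := hmin L' hg'
      have h2 : L' ⊆ L := fun i hi => by simpa using (hw i).1 (h i hi)
      exact hne (Set.eq_of_subset_of_ncard_le h2 h1)
    · rfl
  · simp

end
end BDescent

namespace BDescent

section
variable {n : ℕ} {W : Type*} [Group W] [Fintype W] (cs : CoxeterSystem (BMat n) W)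
  (F : Type*) [Field F]

/-- the span of the `x_L` with `|L| < k` -/
noncomputable def Filt (k : ℕ) : Submodule F (MonoidAlgebra F W) :=
  Submodule.span F (descentElt F cs '' {L | L.ncard < k})

/-- the span of the `x_L` with `L` proper -/
noncomputable def Rad : Submodule F (MonoidAlgebra F W) :=
  Submodule.span F (descentElt F cs '' {L | L ≠ Set.univ})

theorem rad_le : Rad cs F ≤ Filt cs F n := by
  refine Submodule.span_mono (Set.image_mono ?_)
  intro L hL
  have := Set.ncard_lt_ncard (Set.ssubset_univ_iff.2 hL) (Set.toFinite _)
  simpa [Set.ncard_univ] using this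

theorem filt_le {k : ℕ} (hk : k ≤ n) : Filt cs F k ≤ Rad cs F := by
  refine Submodule.span_mono (Set.image_mono ?_)
  rintro L hL rfl
  have hL' : (Set.univ : Set (Fin n)).ncard < k := hL
  simp [Set.ncard_univ] at hL'
  omega

theorem rad_mul (hchar : ringChar F = 2) {a b : MonoidAlgebra F W} {k : ℕ} (ha : a ∈ Rad cs F) (hb : b ∈ Filt cs F (k + 1)) :
    a * b ∈ Filt cs F k := by
  have h : Rad cs F * Filt cs F (k + 1) ≤ Filt cs F k := by
    rw [Rad, Filt, Submodule.span_mul_span, Submodule.span_le]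
    rintro _ ⟨_, ⟨J, hJ, rfl⟩, _, ⟨K, hK, rfl⟩, rfl⟩
    refine Submodule.span_mono (Set.image_mono ?_) (mul_mem cs F hchar hJ K)
    intro L hL
    have h1 := Set.ncard_lt_ncard hL (Set.toFinite _)
    have h2 : K.ncard < k + 1 := hK
    show L.ncard < k
    omega
  exact h (Submodule.mul_mem_mul ha hb)

theorem rad_mul_rad (hchar : ringChar F = 2) (hn : 1 ≤ n) {a b : MonoidAlgebra F W} (ha : a ∈ Rad cs F)
    (hb : b ∈ Rad cs F) : a * b ∈ Filt cs F (n - 1) := by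
  refine rad_mul cs F hchar ha ?_
  rw [Nat.sub_add_cancel hn]
  exact rad_le cs F hb

theorem rad_pow (hchar : ringChar F = 2) {a : MonoidAlgebra F W} (ha : a ∈ Rad cs F) : a ^ (n + 1) = 0 := by
  have h : ∀ k, k ≤ n + 1 → a ^ k ∈ Filt cs F (n + 1 - k) := by
    intro k
    induction k with
    | zero =>
      intro _
      rw [pow_zero, ← descentElt_univ cs F]
      refine Submodule.subset_span ⟨_, ?_, rfl⟩
      show Set.ncard _ < _
      simp [Set.ncard_univ]
    | succ k ih =>
      intro hk
      rw [pow_succ']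
      refine rad_mul cs F hchar ha ?_
      have := ih (by omega)
      rwa [show n + 1 - (k + 1) + 1 = n + 1 - k by omega]
  have := h (n + 1) le_rfl
  simpa [Filt] using this

theorem mem_desc (hchar : ringChar F = 2) (hn : 1 ≤ n) {a : MonoidAlgebra F W} (ha : a ∈ descentAlgebra F cs) :
    ∃ c : F, ∃ i ∈ Rad cs F, a = c • 1 + i := by
  refine Algebra.adjoin_induction (p := fun a _ => ∃ c : F, ∃ i ∈ Rad cs F, a = c • 1 + i)
    ?_ ?_ ?_ ?_ ha
  · rintro _ ⟨J, rfl⟩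
    by_cases hJ : J = Set.univ
    · subst hJ
      exact ⟨1, 0, Submodule.zero_mem _, by rw [descentElt_univ]; simp⟩
    · exact ⟨0, _, Submodule.subset_span ⟨J, hJ, rfl⟩, by simp⟩
  · intro r
    exact ⟨r, 0, Submodule.zero_mem _, by rw [add_zero, Algebra.algebraMap_eq_smul_one]⟩
  · rintro _ _ _ _ ⟨c, i, hi, rfl⟩ ⟨d, j, hj, rfl⟩
    exact ⟨c + d, i + j, Submodule.add_mem _ hi hj, by module⟩
  · rintro _ _ _ _ ⟨c, i, hi, rfl⟩ ⟨d, j, hj, rfl⟩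
    refine ⟨c * d, c • j + d • i + i * j, ?_, ?_⟩
    · refine Submodule.add_mem _ (Submodule.add_mem _ (Submodule.smul_mem _ _ hj)
        (Submodule.smul_mem _ _ hi)) (filt_le cs F (by omega) (rad_mul_rad cs F hchar hn hi hj))
    · simp only [add_mul, mul_add, smul_mul_assoc, mul_smul_comm, one_mul, mul_one, smul_smul]
      module

theorem one_notMem (hchar : ringChar F = 2) : (1 : MonoidAlgebra F W) ∉ Rad cs F := by
  intro h
  have := rad_pow cs F hchar h
  simp at this

theorem rad_le_desc {a : MonoidAlgebra F W} (ha : a ∈ Rad cs F) : a ∈ descentAlgebra F cs := by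
  have : Rad cs F ≤ Subalgebra.toSubmodule (descentAlgebra F cs) := by
    rw [Rad, Submodule.span_le]
    rintro _ ⟨J, -, rfl⟩
    exact Algebra.subset_adjoin ⟨J, rfl⟩
  exact this ha

theorem mem_jac (hchar : ringChar F = 2) (hn : 1 ≤ n) (d : descentAlgebra F cs) :
    d ∈ (⊥ : Ideal (descentAlgebra F cs)).jacobson ↔ (d : MonoidAlgebra F W) ∈ Rad cs F := by
  have hnil : ∀ e : descentAlgebra F cs, (e : MonoidAlgebra F W) ∈ Rad cs F → IsNilpotent e := by
    intro e he
    refine ⟨n + 1, Subtype.ext ?_⟩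
    simpa using rad_pow cs F hchar he
  constructor
  · intro hd
    obtain ⟨c, i, hi, he⟩ := mem_desc cs F hchar hn d.2
    by_cases hc : c = 0
    · rw [he, hc]; simpa using hi
    exfalso
    have hu : IsUnit d := by
      have h1 : d = algebraMap F _ c + ⟨i, rad_le_desc cs F hi⟩ := by
        apply Subtype.ext
        rw [he]
        simp [Algebra.algebraMap_eq_smul_one]
      rw [h1]
      have hcu : IsUnit (algebraMap F (descentAlgebra F cs) c) :=
        (IsUnit.mk0 c hc).map _
      exact (hnil ⟨i, _⟩ hi).isUnit_add_left_of_commute hcu (Algebra.commutes c _).symm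
    have htop := Ideal.eq_top_of_isUnit_mem _ hd hu
    rw [Ideal.jacobson_eq_top_iff] at htop
    exact bot_ne_top htop
  · intro hd
    rw [Ideal.mem_jacobson_iff]
    intro y
    have hy : ((y * d : descentAlgebra F cs) : MonoidAlgebra F W) ∈ Rad cs F := by
      obtain ⟨c, i, hi, he⟩ := mem_desc cs F hchar hn y.2
      rw [Subalgebra.coe_mul, he, add_mul, smul_mul_assoc, one_mul]
      exact Submodule.add_mem _ (Submodule.smul_mem _ _ hd)
        (filt_le cs F (by omega) (rad_mul_rad cs F hchar hn hi hd))
    have hu := (hnil _ hy).isUnit_one_add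
    obtain ⟨z, hz⟩ := hu.exists_left_inv
    refine ⟨z, ?_⟩
    rw [Ideal.mem_bot, ← hz]
    noncomm_ring

theorem exists_dual (K : Set (Fin n)) : ∃ φ : MonoidAlgebra F W →ₗ[F] F,
    φ (descentElt F cs K) = 1 ∧ ∀ L, L ≠ K → φ (descentElt F cs L) = 0 := by
  classical
  have hli := linInd cs F
  obtain ⟨φ, hφ⟩ := LinearMap.exists_extend
    ((Finsupp.lapply K : (Set (Fin n) →₀ F) →ₗ[F] F) ∘ₗ hli.repr)
  have h : ∀ L, φ (descentElt F cs L) = Finsupp.single L (1 : F) K := by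
    intro L
    have h1 := congrArg (fun f => f ⟨descentElt F cs L, Submodule.subset_span ⟨L, rfl⟩⟩) hφ
    simp only [LinearMap.comp_apply, Submodule.subtype_apply, LinearEquiv.coe_coe] at h1
    rw [h1, hli.repr_eq_single L _ rfl]
    rfl
  refine ⟨φ, by rw [h]; simp, fun L hL => by rw [h]; simp [hL]⟩

theorem quot_dim (hchar : ringChar F = 2) (hn : 1 ≤ n) :
    quotDim F (descentAlgebra F cs) (⊥ : Ideal (descentAlgebra F cs)).jacobson = 1 := by
  unfold quotDim
  refine finrank_eq_one
    (Submodule.Quotient.mk 1 : _ ⧸ (⊥ : Ideal (descentAlgebra F cs)).jacobson) ?_ ?_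
  · intro h
    rw [Submodule.Quotient.mk_eq_zero, mem_jac cs F hchar hn] at h
    exact one_notMem cs F hchar (by simpa using h)
  · intro w
    obtain ⟨d, rfl⟩ := Submodule.Quotient.mk_surjective _ w
    obtain ⟨c, i, hi, he⟩ := mem_desc cs F hchar hn d.2
    refine ⟨c, ?_⟩
    rw [← Submodule.Quotient.mk_smul, Submodule.Quotient.eq, mem_jac cs F hchar hn]
    have h1 : ((c • (1 : descentAlgebra F cs) - d : descentAlgebra F cs) : MonoidAlgebra F W)
        = -i := by
      rw [Subalgebra.coe_sub, he]
      simp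
    rw [h1]
    exact Submodule.neg_mem _ hi

theorem subquot_le {m : ℕ} (F : Type*) [Field F] (R : Type*) [Ring R] [Algebra F R]
    [FiniteDimensional F R] (I K : Ideal R) (y : Fin m → R) (hy : ∀ i, y i ∈ I)
    (h : ∀ g : Fin m → F, ∑ i, g i • y i ∈ K → ∀ i, g i = 0) : m ≤ subquotDim F R I K := by
  let z : Fin m → I.restrictScalars F := fun i => ⟨y i, hy i⟩
  have hli : LinearIndependent F (fun i => (Submodule.Quotient.mk (z i) :
      (I.restrictScalars F) ⧸ Submodule.comap (I.restrictScalars F).subtype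
        (K.restrictScalars F))) := by
    rw [Fintype.linearIndependent_iff]
    intro g hg
    have h1 : (Submodule.Quotient.mk (∑ j, g j • z j) :
      (I.restrictScalars F) ⧸ Submodule.comap (I.restrictScalars F).subtype
        (K.restrictScalars F)) = 0 := by
      rw [← hg, ← Submodule.mkQ_apply, map_sum]
      rfl
    rw [Submodule.Quotient.mk_eq_zero, Submodule.mem_comap] at h1
    apply h
    simpa [z] using h1
  have := hli.fintype_card_le_finrank
  rw [Fintype.card_fin] at this
  exact this

theorem subquot_dim (hchar : ringChar F = 2) (hn : 2 ≤ n) :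
    n ≤ subquotDim F (descentAlgebra F cs) (⊥ : Ideal (descentAlgebra F cs)).jacobson
      ((⊥ : Ideal (descentAlgebra F cs)).jacobson • (⊥ : Ideal (descentAlgebra F cs)).jacobson) := by
  have hn1 : 1 ≤ n := by omega
  set Jac := (⊥ : Ideal (descentAlgebra F cs)).jacobson with hJac
  have hsq : ∀ d : descentAlgebra F cs, d ∈ Jac • Jac →
      (d : MonoidAlgebra F W) ∈ Filt cs F (n - 1) := by
    intro d hd
    refine Submodule.smul_induction_on hd ?_ ?_
    · intro r hr m hm
      exact rad_mul_rad cs F hchar hn1 ((mem_jac cs F hchar hn1 r).1 hr)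
        ((mem_jac cs F hchar hn1 m).1 hm)
    · intro x y hx hy
      exact Submodule.add_mem _ hx hy
  have hmem : ∀ i : Fin n, descentElt F cs {i}ᶜ ∈ Rad cs F := fun i =>
    Submodule.subset_span ⟨_, by simp, rfl⟩
  have hfin : FiniteDimensional F (MonoidAlgebra F W) :=
    Module.Finite.of_basis (MonoidAlgebra.basis W F)
  refine subquot_le F (descentAlgebra F cs) Jac (Jac • Jac)
    (fun i => ⟨descentElt F cs {i}ᶜ, rad_le_desc cs F (hmem i)⟩)
    (fun i => (mem_jac cs F hchar hn1 _).2 (hmem i)) ?_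
  · intro g h1 i
    have h2 := hsq _ h1
    have h3 : ((∑ j, g j • (⟨descentElt F cs {j}ᶜ, rad_le_desc cs F (hmem j)⟩ :
        descentAlgebra F cs) : descentAlgebra F cs) :
        MonoidAlgebra F W) = ∑ j, g j • descentElt F cs {j}ᶜ := by
      simp
    rw [h3] at h2
    obtain ⟨φ, hφ1, hφ0⟩ := exists_dual cs F ({i}ᶜ : Set (Fin n))
    have h4 : Filt cs F (n - 1) ≤ LinearMap.ker φ := by
      rw [Filt, Submodule.span_le]
      rintro _ ⟨L, hL, rfl⟩
      refine hφ0 L ?_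
      rintro rfl
      have hL' : ({i}ᶜ : Set (Fin n)).ncard < n - 1 := hL
      rw [Set.ncard_compl, Set.ncard_singleton, Nat.card_eq_fintype_card, Fintype.card_fin] at hL'
      omega
    have h5 : φ (∑ j, g j • descentElt F cs {j}ᶜ) = 0 := h4 h2
    rw [map_sum, Finset.sum_eq_single i] at h5
    · simpa [hφ1] using h5
    · intro j _ hj
      rw [map_smul, hφ0, smul_zero]
      intro hc
      exact hj (by simpa using hc)
    · simp

end
end BDescent

/-- If `char F = 2`, the descent algebra `D = D_F(B_n)` has a unique simple module
(`D/J(D)` is one-dimensional over `F`), and `dim_F J(D)/J(D)² ≥ n`: the Ext-quiver of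
`D_F(B_n)` is a single vertex with at least `n` loops. -/
theorem stmt_11 (F : Type*) [Field F] (n : ℕ) (hn : 2 ≤ n)
    (W : Type*) [Group W] [Fintype W] (cs : CoxeterSystem (BMat n) W)
    (hchar : ringChar F = 2)
    (D : Subalgebra F (MonoidAlgebra F W)) (hD : D = descentAlgebra F cs)
    (Jac : Ideal ↥D) (hJac : Jac = (⊥ : Ideal ↥D).jacobson) :
    quotDim F ↥D Jac = 1 ∧ n ≤ subquotDim F ↥D Jac (Jac • Jac) := by
  subst hD hJac
  exact ⟨BDescent.quot_dim cs F hchar (by omega), BDescent.subquot_dim cs F hchar hn⟩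
end

section
/- Suppose the characteristic of F is 2, n ≥ 4 and n is even, and let D = D_F(D_n) with Jacobson radical J(D). Then D/J(D) is one-dimensional over F (so D has a unique simple module up to isomorphism), and the F-dimension of J(D)/J(D)² is at least n. (Equivalently, the Ext-quiver of D_F(D_n) is a single vertex with at least n loops.) -/
set_option maxHeartbeats 1000000
set_option synthInstance.maxHeartbeats 1000000

theorem subquot_lower (F : Type*) [Field F] {B : Type*} [Fintype B] (R : Type*) [Ring R]
    [Algebra F R] [Module.Finite F R] (I K : Ideal R)
    (g : (I.restrictScalars F) →ₗ[F] (B → F))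
    (hker : ∀ a : I.restrictScalars F, (a : R) ∈ K → g a = 0)
    (hsurj : Function.Surjective g) : Fintype.card B ≤ subquotDim F R I K := by
  unfold subquotDim
  have hk : Submodule.comap (I.restrictScalars F).subtype (K.restrictScalars F) ≤
      LinearMap.ker g := fun a ha => hker a ha
  have hsurj' : Function.Surjective (Submodule.liftQ (Submodule.comap
        (I.restrictScalars F).subtype (K.restrictScalars F)) g hk) := by
    intro y
    obtain ⟨x, rfl⟩ := hsurj y
    exact ⟨Submodule.Quotient.mk x, Submodule.liftQ_apply _ _ _⟩
  have hle := LinearMap.finrank_le_finrank_of_surjective hsurj'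
  rwa [Module.finrank_fintype_fun_eq_card] at hle

/-! ### The reflection cocycle of a Coxeter system -/

lemma end_mul_apply {α : Type*} (f g : Function.End α) (x : α) : (f * g) x = f (g x) := rfl

lemma end_one_apply {α : Type*} (x : α) : (1 : Function.End α) x = x := rfl

section Cocycle

variable {B W : Type*} [Group W] {M : CoxeterMatrix B} (cs : CoxeterSystem M W)

open Classical in
/-- Elementary step of the action of the Coxeter group on `W × ZMod 2`. -/
noncomputable def cocStep (i : B) : Function.End (W × ZMod 2) :=
  fun x => (cs.simple i * x.1 * cs.simple i, x.2 + if x.1 = cs.simple i then 1 else 0)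

open Classical in
lemma cocStep_pow (i j : B) (k : ℕ) (x : W × ZMod 2) :
    ((cocStep cs i * cocStep cs j) ^ k) x =
      ((cs.simple i * cs.simple j) ^ k * x.1 * ((cs.simple i * cs.simple j) ^ k)⁻¹,
        x.2 + ∑ l ∈ Finset.range (2 * k),
          if x.1 = ((cs.simple i * cs.simple j) ^ l)⁻¹ * cs.simple j then (1 : ZMod 2) else 0) := by
  set p := cs.simple i * cs.simple j with hp
  have hcom : ∀ m : ℕ, cs.simple j * p ^ m = (p ^ m)⁻¹ * cs.simple j := by
    intro m
    induction m with
    | zero => simp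
    | succ m ih =>
      have h1 : cs.simple j * p = p⁻¹ * cs.simple j := by
        simp [hp, mul_assoc]
      rw [pow_succ, ← mul_assoc, ih, mul_assoc, h1, ← pow_succ, pow_succ', mul_inv_rev p,
        mul_assoc]
  induction k with
  | zero => simp [end_one_apply]
  | succ k ih =>
    rw [pow_succ', end_mul_apply, ih]
    have e1 : (p ^ k * x.1 * (p ^ k)⁻¹ = cs.simple j) ↔ x.1 = (p ^ (2 * k))⁻¹ * cs.simple j := by
      rw [mul_inv_eq_iff_eq_mul, hcom, ← eq_inv_mul_iff_mul_eq, ← mul_assoc, two_mul, pow_add,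
        mul_inv_rev]
    have e2 : (cs.simple j * (p ^ k * x.1 * (p ^ k)⁻¹) * cs.simple j = cs.simple i) ↔
        x.1 = (p ^ (2 * k + 1))⁻¹ * cs.simple j := by
      have h3 : cs.simple j * (p ^ k * x.1 * (p ^ k)⁻¹) * cs.simple j = cs.simple i ↔
          p ^ k * x.1 * (p ^ k)⁻¹ = p⁻¹ * cs.simple j := by
        constructor
        · intro h
          have := congrArg (fun y => cs.simple j * y * cs.simple j) h
          simpa [mul_assoc, hp] using this
        · intro h
          rw [h]; simp [hp, mul_assoc]
      rw [h3, mul_inv_eq_iff_eq_mul, mul_assoc, hcom, ← eq_inv_mul_iff_mul_eq, two_mul,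
        pow_add, pow_add, pow_one, mul_assoc, ← pow_succ, pow_succ', ]
      simp [mul_assoc]
    rw [show 2 * (k + 1) = 2 * k + 1 + 1 by ring, Finset.sum_range_succ, Finset.sum_range_succ,
      end_mul_apply]
    simp only [cocStep, e1, e2]
    refine Prod.ext ?_ ?_
    · simp only [pow_succ', hp, mul_inv_rev, CoxeterSystem.inv_simple, mul_assoc]
    · simp only [add_assoc]

lemma cocStep_liftable : M.IsLiftable (cocStep cs) := by
  classical
  intro i j
  funext x
  rw [cocStep_pow, cs.simple_mul_simple_pow, two_mul, Finset.sum_range_add]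
  have : ∀ l, (cs.simple i * cs.simple j) ^ (M i j + l) = (cs.simple i * cs.simple j) ^ l := by
    intro l
    rw [pow_add, cs.simple_mul_simple_pow, one_mul]
  simp only [this, CharTwo.add_self_eq_zero]
  simp
  rfl

/-- The action of `W` on `W × ZMod 2`. -/
noncomputable def cocAct : W →* Function.End (W × ZMod 2) := cs.lift ⟨_, cocStep_liftable cs⟩

/-- The reflection cocycle. -/
noncomputable def eta (w t : W) : ZMod 2 := (cocAct cs w (t, 0)).2

lemma cocAct_simple (i : B) : cocAct cs (cs.simple i) = cocStep cs i :=
  cs.lift_apply_simple (cocStep_liftable cs) i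

lemma cocAct_apply (w t : W) (e : ZMod 2) :
    cocAct cs w (t, e) = (w * t * w⁻¹, e + eta cs w t) := by
  unfold eta
  induction w using cs.simple_induction_left generalizing t e with
  | one => simp [end_one_apply]
  | mul_simple_left w i ih =>
    rw [map_mul, end_mul_apply, end_mul_apply, ih t e, ih t 0,
      cocAct_simple]
    simp [cocStep, mul_assoc]
    rw [add_assoc]

lemma eta_mul (u v t : W) : eta cs (u * v) t = eta cs v t + eta cs u (v * t * v⁻¹) := by
  conv_lhs => rw [eta, map_mul, end_mul_apply, cocAct_apply,
    cocAct_apply]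
  simp

open Classical in
lemma eta_simple (i : B) (t : W) : eta cs (cs.simple i) t = if t = cs.simple i then 1 else 0 := by
  rw [eta, cocAct_simple]
  simp [cocStep]

lemma eta_simple_self (i : B) : eta cs (cs.simple i) (cs.simple i) = 1 := by
  simp [eta_simple]

@[simp] lemma eta_one (t : W) : eta cs 1 t = 0 := by
  simp [eta, end_one_apply]

/-- Strong exchange. -/
lemma eta_exchange (ω : List B) (t : W) (h : eta cs (cs.wordProd ω) t ≠ 0) :
    ∃ ω' : List B, ω'.length + 1 = ω.length ∧ (∀ i ∈ ω', i ∈ ω) ∧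
      cs.wordProd ω' = cs.wordProd ω * t := by
  induction ω with
  | nil => simp at h
  | cons i ω ih =>
    rw [cs.wordProd_cons, eta_mul] at h
    by_cases h0 : eta cs (cs.wordProd ω) t = 0
    · rw [h0, zero_add, eta_simple] at h
      have h1 : cs.wordProd ω * t * (cs.wordProd ω)⁻¹ = cs.simple i := by
        by_contra h2
        simp [h2] at h
      refine ⟨ω, rfl, fun j hj => List.mem_cons_of_mem _ hj, ?_⟩
      rw [mul_inv_eq_iff_eq_mul] at h1
      rw [cs.wordProd_cons, mul_assoc, h1]
      simp
    · obtain ⟨ω', h1, h2, h3⟩ := ih h0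
      refine ⟨i :: ω', by simp [h1], ?_, ?_⟩
      · intro j hj
        rcases List.mem_cons.1 hj with rfl | hj
        · exact List.mem_cons_self
        · exact List.mem_cons_of_mem _ (h2 j hj)
      · rw [cs.wordProd_cons, cs.wordProd_cons, h3, mul_assoc]

lemma length_lt_of_eta (w t : W) (h : eta cs w t ≠ 0) : cs.length (w * t) < cs.length w := by
  obtain ⟨ω, hω, rfl⟩ := cs.exists_isReduced w
  obtain ⟨ω', h1, -, h3⟩ := eta_exchange cs ω t h
  rw [← h3, hω.eq]
  have := cs.length_wordProd_le ω'
  omega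

lemma eta_mul_simple (w : W) (i : B) :
    eta cs (w * cs.simple i) (cs.simple i) = 1 + eta cs w (cs.simple i) := by
  rw [eta_mul, eta_simple_self]
  simp

lemma length_lt_iff (w : W) (i : B) :
    cs.length w < cs.length (w * cs.simple i) ↔ eta cs w (cs.simple i) = 0 := by
  constructor
  · intro h
    by_contra h0
    exact absurd (length_lt_of_eta cs w _ h0) (by omega)
  · intro h
    have := length_lt_of_eta cs (w * cs.simple i) (cs.simple i)
      (by rw [eta_mul_simple, h]; simp)
    simpa using this

/-- The standard parabolic subgroup. -/
def parab (J : Set B) : Subgroup W := Subgroup.closure (cs.simple '' J)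

lemma simple_mem_parab {J : Set B} {i : B} (h : i ∈ J) : cs.simple i ∈ parab cs J :=
  Subgroup.subset_closure ⟨i, h, rfl⟩

lemma parab_word {J : Set B} {p : W} (hp : p ∈ parab cs J) :
    ∃ ω : List B, (∀ i ∈ ω, i ∈ J) ∧ cs.wordProd ω = p := by
  induction hp using Subgroup.closure_induction with
  | mem x hx =>
    obtain ⟨i, hi, rfl⟩ := hx
    exact ⟨[i], by simpa using hi, by simp⟩
  | one => exact ⟨[], by simp, by simp⟩
  | mul x y _ _ hx hy =>
    obtain ⟨a, ha, rfl⟩ := hx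
    obtain ⟨b, hb, rfl⟩ := hy
    refine ⟨a ++ b, ?_, cs.wordProd_append a b⟩
    intro i hi
    rcases List.mem_append.1 hi with h | h
    · exact ha i h
    · exact hb i h
  | inv x _ hx =>
    obtain ⟨a, ha, rfl⟩ := hx
    exact ⟨a.reverse, by simpa using ha, by simp⟩

lemma parab_wordProd {J : Set B} {ω : List B} (h : ∀ i ∈ ω, i ∈ J) :
    cs.wordProd ω ∈ parab cs J := by
  induction ω with
  | nil => simp [one_mem]
  | cons i ω ih =>
    rw [cs.wordProd_cons]
    exact mul_mem (simple_mem_parab cs (h i List.mem_cons_self))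
      (ih fun j hj => h j (List.mem_cons_of_mem _ hj))

lemma eta_parab_of_not_mem {J : Set B} {p t : W} (hp : p ∈ parab cs J) (ht : t ∉ parab cs J) :
    eta cs p t = 0 := by
  obtain ⟨ω, hω, rfl⟩ := parab_word cs hp
  by_contra h
  obtain ⟨ω', -, h2, h3⟩ := eta_exchange cs ω t h
  apply ht
  have : t = (cs.wordProd ω)⁻¹ * cs.wordProd ω' := by rw [h3]; group
  rw [this]
  exact mul_mem (inv_mem hp) (parab_wordProd cs fun i hi => hω i (h2 i hi))

lemma parab_eq_one {J : Set B} {p : W} (hp : p ∈ parab cs J)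
    (h : ∀ i ∈ J, eta cs p (cs.simple i) = 0) : p = 1 := by
  classical
  obtain ⟨ω₀, hω₀, hp₀⟩ := parab_word cs hp
  have hex : ∃ k, ∃ ω : List B, ω.length = k ∧ (∀ i ∈ ω, i ∈ J) ∧ cs.wordProd ω = p :=
    ⟨_, ω₀, rfl, hω₀, hp₀⟩
  obtain ⟨ω, h1, h2, h3⟩ := Nat.find_spec hex
  rcases List.eq_nil_or_concat ω with rfl | ⟨ω', i, rfl⟩
  · simpa using h3.symm
  · exfalso
    have hi : i ∈ J := h2 i (by simp)
    have hpi := h i hi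
    rw [← h3, cs.wordProd_concat, eta_mul_simple] at hpi
    obtain ⟨ω'', k1, k2, k3⟩ := eta_exchange cs ω' (cs.simple i) (by
      intro h0; rw [h0] at hpi; simp at hpi)
    refine Nat.find_min hex (m := ω''.length) ?_ ⟨ω'', rfl, ?_, ?_⟩
    · rw [← h1]; simp; omega
    · intro j hj
      exact h2 j (by simp [k2 j hj])
    · rw [k3, ← h3, cs.wordProd_concat]

/-- `X_J`. -/
def XJ (J : Set B) : Set W := {w | ∀ i ∈ J, eta cs w (cs.simple i) = 0}

lemma exists_min (J : Set B) (w : W) :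
    ∃ u, w⁻¹ * u ∈ parab cs J ∧ ∀ r ∈ parab cs J, eta cs u r = 0 := by
  classical
  have hex : ∃ k, ∃ u, cs.length u = k ∧ w⁻¹ * u ∈ parab cs J :=
    ⟨_, w, rfl, by simp [one_mem]⟩
  obtain ⟨u, h1, h2⟩ := Nat.find_spec hex
  refine ⟨u, h2, fun r hr => ?_⟩
  by_contra h0
  refine Nat.find_min hex (m := cs.length (u * r)) ?_ ⟨u * r, rfl, ?_⟩
  · rw [← h1]; exact length_lt_of_eta cs u r h0
  · rw [← mul_assoc]; exact mul_mem h2 hr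

lemma exists_rep (J : Set B) (w : W) : ∃ u ∈ XJ cs J, w⁻¹ * u ∈ parab cs J := by
  obtain ⟨u, h1, h2⟩ := exists_min cs J w
  exact ⟨u, fun i hi => h2 _ (simple_mem_parab cs hi), h1⟩

lemma parab_conj {J : Set B} {p r : W} (hp : p ∈ parab cs J) (hr : r ∈ parab cs J) :
    p * r * p⁻¹ ∈ parab cs J := mul_mem (mul_mem hp hr) (inv_mem hp)

lemma XJ_eq_of_min {J : Set B} {u u₀ : W} (hu : u ∈ XJ cs J)
    (h₀ : ∀ r ∈ parab cs J, eta cs u₀ r = 0) (h : u₀⁻¹ * u ∈ parab cs J) : u = u₀ := by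
  have h1 : u₀⁻¹ * u = 1 := by
    refine parab_eq_one cs h fun i hi => ?_
    have h2 := hu i hi
    rw [show u = u₀ * (u₀⁻¹ * u) by group, eta_mul,
      h₀ _ (parab_conj cs h (simple_mem_parab cs hi)), add_zero] at h2
    exact h2
  exact (inv_mul_eq_one.1 h1).symm

lemma eta_XJ {J : Set B} {u r : W} (hu : u ∈ XJ cs J) (hr : r ∈ parab cs J) :
    eta cs u r = 0 := by
  obtain ⟨u₀, h1, h2⟩ := exists_min cs J u
  have := XJ_eq_of_min cs hu h2 (by simpa using inv_mem h1)
  rw [this]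
  exact h2 r hr

lemma XJ_unique {J : Set B} {u v : W} (hu : u ∈ XJ cs J) (hv : v ∈ XJ cs J)
    (h : v⁻¹ * u ∈ parab cs J) : u = v :=
  XJ_eq_of_min cs hu (fun _ hr => eta_XJ cs hv hr) h

/-- The representative of `w W_J` in `X_J`. -/
noncomputable def rep (J : Set B) (w : W) : W := (exists_rep cs J w).choose

lemma rep_mem (J : Set B) (w : W) : rep cs J w ∈ XJ cs J := (exists_rep cs J w).choose_spec.1

lemma rep_parab (J : Set B) (w : W) : w⁻¹ * rep cs J w ∈ parab cs J :=
  (exists_rep cs J w).choose_spec.2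

lemma rep_rep {J : Set B} {g h u : W} (hgh : g * h = 1) (hu : u ∈ XJ cs J) :
    rep cs J (g * rep cs J (h * u)) = u := by
  refine XJ_unique cs (rep_mem cs J _) hu ?_
  have h1 := rep_parab cs J (g * rep cs J (h * u))
  have h2 := rep_parab cs J (h * u)
  have h3 := mul_mem h2 h1
  have h4 : g⁻¹ = h := inv_eq_of_mul_eq_one_right hgh
  have h5 : (h * u)⁻¹ * rep cs J (h * u) *
      ((g * rep cs J (h * u))⁻¹ * rep cs J (g * rep cs J (h * u))) =
      u⁻¹ * rep cs J (g * rep cs J (h * u)) := by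
    rw [← h4]; group
  rwa [h5] at h3

end Cocycle
/-! ### Solomon's product formula -/

section Solomon

variable (F : Type*) [Field F] {B W : Type*} [Group W] [Fintype W] {M : CoxeterMatrix B}
  (cs : CoxeterSystem M W)

open Classical in
lemma descentElt_eq (J : Set B) : descentElt F cs J =
    ∑ w : W, if w ∈ XJ cs J then MonoidAlgebra.of F W w else 0 := by
  unfold descentElt XJ
  simp only [length_lt_iff, Set.mem_ofPred_eq]

/-- The elements of `K` stabilising the coset `u W_J`. -/
def stabK (J K : Set B) (u : W) : Set B := {i | i ∈ K ∧ u⁻¹ * cs.simple i * u ∈ parab cs J}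

/-- The coset `u W_J` is weakly dominant for `K`. -/
def domK (J K : Set B) (u : W) : Prop :=
  ∀ i ∈ K, u⁻¹ * cs.simple i * u ∉ parab cs J → eta cs u⁻¹ (cs.simple i) = 0

lemma solomon_key {J : Set B} (K : Set B) {u : W} (hu : u ∈ XJ cs J) (g : W) :
    u⁻¹ * g ∈ XJ cs K ↔
      domK cs J K (rep cs J (g⁻¹ * u)) ∧ g ∈ XJ cs (stabK cs J K (rep cs J (g⁻¹ * u))) := by
  set u' := rep cs J (g⁻¹ * u) with hu'
  have hp := rep_parab cs J (g⁻¹ * u)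
  rw [← hu'] at hp
  set p := (g⁻¹ * u)⁻¹ * u' with hpdef
  have hug : u⁻¹ * g = p * u'⁻¹ := by rw [hpdef]; group
  have h1 : ∀ i, u'⁻¹ * cs.simple i * u' ∉ parab cs J →
      eta cs (u⁻¹ * g) (cs.simple i) = eta cs u'⁻¹ (cs.simple i) := by
    intro i hi
    rw [hug, eta_mul, eta_parab_of_not_mem cs hp (by simpa using hi), add_zero]
  have h2 : ∀ i, u'⁻¹ * cs.simple i * u' ∈ parab cs J →
      eta cs (u⁻¹ * g) (cs.simple i) = eta cs g (cs.simple i) := by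
    intro i hi
    have hr := parab_conj cs hp hi
    have e : g * cs.simple i * g⁻¹ = u * (p * (u'⁻¹ * cs.simple i * u') * p⁻¹) * u⁻¹ := by
      rw [hpdef]; group
    have h3 := eta_mul cs u⁻¹ u (p * (u'⁻¹ * cs.simple i * u') * p⁻¹)
    rw [inv_mul_cancel, eta_one, eta_XJ cs hu hr, zero_add] at h3
    rw [eta_mul, e, ← h3, add_zero]
  constructor
  · intro h
    refine ⟨fun i hi hn => ?_, fun i hi => ?_⟩
    · rw [← h1 i hn]; exact h i hi
    · rw [← h2 i hi.2]; exact h i hi.1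
  · rintro ⟨ha, hb⟩ i hi
    by_cases hc : u'⁻¹ * cs.simple i * u' ∈ parab cs J
    · rw [h2 i hc]; exact hb i ⟨hi, hc⟩
    · rw [h1 i hc]; exact ha i hi hc

open Classical in
lemma solomon (J K : Set B) : descentElt F cs J * descentElt F cs K =
    ∑ u ∈ Finset.univ.filter (fun u : W => u ∈ XJ cs J ∧ domK cs J K u),
      descentElt F cs (stabK cs J K u) := by
  have hL : descentElt F cs J * descentElt F cs K =
      ∑ g : W, ∑ u ∈ Finset.univ.filter (fun u : W => u ∈ XJ cs J ∧ u⁻¹ * g ∈ XJ cs K),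
        MonoidAlgebra.of F W g := by
    rw [descentElt_eq, descentElt_eq, Finset.sum_mul]
    simp only [Finset.sum_filter]
    rw [Finset.sum_comm]
    refine Finset.sum_congr rfl fun u _ => ?_
    by_cases hu : u ∈ XJ cs J
    · simp only [hu, if_true, true_and]
      rw [Finset.mul_sum]
      refine Fintype.sum_equiv (Equiv.mulLeft u) _ _ fun v => ?_
      simp only [Equiv.coe_mulLeft, inv_mul_cancel_left]
      split_ifs
      · rw [map_mul]
      · rw [mul_zero]
    · simp [hu]
  rw [hL]
  simp only [descentElt_eq]
  rw [Finset.sum_comm]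
  refine Finset.sum_congr rfl fun g _ => ?_
  rw [← Finset.sum_filter, Finset.filter_filter]
  refine Finset.sum_nbij' (fun u => rep cs J (g⁻¹ * u)) (fun u => rep cs J (g * u)) ?_ ?_ ?_ ?_ ?_
  · intro u hu
    simp only [Finset.mem_filter, Finset.mem_univ, true_and] at hu ⊢
    have := (solomon_key cs K hu.1 g).1 hu.2
    exact ⟨⟨rep_mem cs J _, this.1⟩, this.2⟩
  · intro u hu
    simp only [Finset.mem_filter, Finset.mem_univ, true_and] at hu ⊢
    refine ⟨rep_mem cs J _, (solomon_key cs K (rep_mem cs J _) g).2 ?_⟩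
    rw [rep_rep cs (by group) hu.1.1]
    exact ⟨hu.1.2, hu.2⟩
  · intro u hu
    simp only [Finset.mem_filter, Finset.mem_univ, true_and] at hu
    exact rep_rep cs (by group) hu.1
  · intro u hu
    simp only [Finset.mem_filter, Finset.mem_univ, true_and] at hu
    exact rep_rep cs (by group) hu.1.1
  · intro u _
    rfl

lemma stabK_subset (J K : Set B) (u : W) : stabK cs J K u ⊆ K := fun _ h => h.1

lemma solomon_mem (J K : Set B) : descentElt F cs J * descentElt F cs K ∈
    Submodule.span F (descentElt F cs '' {L | L ⊆ K}) := by
  classical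
  rw [solomon]
  exact Submodule.sum_mem _ fun u _ =>
    Submodule.subset_span ⟨_, stabK_subset cs J K u, rfl⟩

lemma solomon_mem_ssubset [CharP F 2] (z : W) (hz : ∀ w, z * w = w * z) (hz2 : z * z = 1)
    (J K : Set B) (hzJ : z ∉ parab cs J) : descentElt F cs J * descentElt F cs K ∈
    Submodule.span F (descentElt F cs '' {L | L ⊂ K}) := by
  classical
  have hzi : z⁻¹ = z := inv_eq_of_mul_eq_one_right hz2
  rw [solomon, ← Finset.sum_filter_add_sum_filter_not _ (fun u => stabK cs J K u = K)]
  refine Submodule.add_mem _ ?_ ?_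
  · convert Submodule.zero_mem _
    refine Finset.sum_involution (fun u _ => rep cs J (z * u)) ?_ ?_ ?_ ?_
    all_goals
      intro u hu
      simp only [Finset.mem_filter, Finset.mem_univ, true_and] at hu
    all_goals
      have hp := rep_parab cs J (z * u)
    all_goals
      have hst : stabK cs J K (rep cs J (z * u)) = K := by
        refine Set.Subset.antisymm (stabK_subset cs _ _ _) fun i hi => ⟨hi, ?_⟩
        have h1 : u⁻¹ * cs.simple i * u ∈ parab cs J := by
          rw [← hu.2] at hi
          exact hi.2
        have h2 := mul_mem (mul_mem (inv_mem hp) h1) hp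
        have e : ((z * u)⁻¹ * rep cs J (z * u))⁻¹ * (u⁻¹ * cs.simple i * u) *
            ((z * u)⁻¹ * rep cs J (z * u)) =
            (rep cs J (z * u))⁻¹ * (z * cs.simple i * z⁻¹) * rep cs J (z * u) := by group
        rw [e, hz (cs.simple i), mul_inv_cancel_right] at h2
        exact h2
    · rw [hst, hu.2]
      have : (2 : F) = 0 := CharTwo.two_eq_zero
      rw [← two_smul F, this, zero_smul]
    · intro _ he
      rw [he] at hp
      apply hzJ
      rw [hz u, mul_inv_rev, hzi, hz] at hp
      have h3 : u⁻¹ * z * u = z := by rw [mul_assoc, hz u, inv_mul_cancel_left]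
      rw [mul_assoc, ← mul_assoc] at hp
      simpa [hz, mul_assoc] using hp
    · simp only [Finset.mem_filter, Finset.mem_univ, true_and]
      refine ⟨⟨rep_mem cs J _, fun i hi hn => ?_⟩, hst⟩
      rw [← hst] at hi
      exact absurd hi.2 hn
    · exact rep_rep cs hz2 hu.1.1
  · refine Submodule.sum_mem _ fun u hu => Submodule.subset_span ⟨_, ?_, rfl⟩
    simp only [Finset.mem_filter, Finset.mem_univ, true_and] at hu
    exact lt_of_le_of_ne (stabK_subset cs J K u) hu.2

lemma descentElt_univ : descentElt F cs Set.univ = 1 := by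
  classical
  rw [descentElt_eq, Finset.sum_eq_single (1 : W)]
  · rw [if_pos]
    · exact map_one _
    · intro i _; simp
  · intro w _ hw
    rw [if_neg]
    intro h
    refine hw (parab_eq_one cs (J := Set.univ) ?_ h)
    rw [parab, Set.image_univ, cs.subgroup_closure_range_simple]
    trivial
  · simp

open Classical in
lemma coeff_descentElt (J : Set B) (w : W) :
    (descentElt F cs J).coeff w = if w ∈ XJ cs J then 1 else 0 := by
  rw [descentElt_eq, MonoidAlgebra.coeff_sum, Finset.sum_apply']
  rw [Finset.sum_eq_single w]
  · split_ifs <;> simp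
  · intro v _ hv
    split_ifs
    · simp [Finsupp.single_apply, hv]
    · simp
  · simp

/-- Every subset is a descent set. -/
lemma exists_descent (hs : ∀ (i : B) (K : Set B), i ∉ K → cs.simple i ∉ parab cs K) (K : Set B) :
    ∃ w : W, ∀ i, eta cs w (cs.simple i) = 0 ↔ i ∉ K := by
  classical
  obtain ⟨w, hw, hmax⟩ := Finset.exists_max_image
    (Finset.univ.filter (fun w : W => w ∈ parab cs K)) cs.length ⟨1, by simp [one_mem]⟩
  simp only [Finset.mem_filter, Finset.mem_univ, true_and] at hw hmax
  refine ⟨w, fun i => ⟨fun h hi => ?_, fun h => eta_parab_of_not_mem cs hw (hs i K h)⟩⟩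
  have h1 := (length_lt_iff cs w i).2 h
  have h2 := hmax _ (mul_mem hw (simple_mem_parab cs hi))
  omega

end Solomon

section Algebra

variable (F : Type*) [Field F] {B W : Type*} [Fintype B] [Group W] [Fintype W]
  {M : CoxeterMatrix B} (cs : CoxeterSystem M W)

/-- The filtration of the descent algebra. -/
noncomputable def filt (m : ℕ) : Submodule F (MonoidAlgebra F W) :=
  Submodule.span F (descentElt F cs '' {L | L.ncard + m ≤ Fintype.card B})

lemma descentElt_mem_filt {L : Set B} {m : ℕ} (h : L.ncard + m ≤ Fintype.card B) :
    descentElt F cs L ∈ filt F cs m := Submodule.subset_span ⟨L, h, rfl⟩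

lemma ncard_le (L : Set B) : L.ncard ≤ Fintype.card B := by
  rw [← Nat.card_eq_fintype_card, ← Set.ncard_univ]
  exact Set.ncard_le_ncard (Set.subset_univ _)

lemma ncard_lt {L : Set B} (h : L ≠ Set.univ) : L.ncard + 1 ≤ Fintype.card B := by
  rw [← Nat.card_eq_fintype_card, ← Set.ncard_univ]
  exact Set.ncard_lt_ncard (lt_of_le_of_ne (Set.subset_univ _) h)

lemma ne_univ_of_ncard {L : Set B} (h : L.ncard + 1 ≤ Fintype.card B) : L ≠ Set.univ := by
  rintro rfl
  rw [Set.ncard_univ, Nat.card_eq_fintype_card] at h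
  omega

lemma filt_mul_mem {m k l : ℕ}
    (h : ∀ J K : Set B, J.ncard + m ≤ Fintype.card B → K.ncard + k ≤ Fintype.card B →
      descentElt F cs J * descentElt F cs K ∈ filt F cs l)
    {a b : MonoidAlgebra F W} (ha : a ∈ filt F cs m) (hb : b ∈ filt F cs k) :
    a * b ∈ filt F cs l := by
  have h1 : filt F cs m * filt F cs k ≤ filt F cs l := by
    unfold filt
    rw [Submodule.span_mul_span, Submodule.span_le]
    rintro _ ⟨_, ⟨J, hJ, rfl⟩, _, ⟨K, hK, rfl⟩, rfl⟩
    exact h J K hJ hK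
  exact h1 (Submodule.mul_mem_mul ha hb)

lemma filt_zero_mul {k : ℕ} {a b : MonoidAlgebra F W} (ha : a ∈ filt F cs 0)
    (hb : b ∈ filt F cs k) : a * b ∈ filt F cs k := by
  refine filt_mul_mem F cs (fun J K _ hK => ?_) ha hb
  refine Submodule.span_mono (Set.image_mono ?_) (solomon_mem F cs J K)
  intro L hL
  have := Set.ncard_le_ncard (t := K) hL
  simp only [Set.mem_ofPred_eq]
  omega

lemma filt_one_mul [CharP F 2] (z : W) (hz : ∀ w, z * w = w * z) (hz2 : z * z = 1)
    (hzJ : ∀ J : Set B, J ≠ Set.univ → z ∉ parab cs J) {k : ℕ}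
    {a b : MonoidAlgebra F W} (ha : a ∈ filt F cs 1)
    (hb : b ∈ filt F cs k) : a * b ∈ filt F cs (k + 1) := by
  refine filt_mul_mem F cs (fun J K hJ hK => ?_) ha hb
  refine Submodule.span_mono (Set.image_mono ?_)
    (solomon_mem_ssubset F cs z hz hz2 J K (hzJ J (ne_univ_of_ncard hJ)))
  intro L hL
  have := Set.ncard_lt_ncard (t := K) hL
  simp only [Set.mem_ofPred_eq]
  omega

lemma one_mem_filt : (1 : MonoidAlgebra F W) ∈ filt F cs 0 := by
  rw [← descentElt_univ F cs]
  exact descentElt_mem_filt F cs (ncard_le _)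

lemma filt_nilp [CharP F 2] (z : W) (hz : ∀ w, z * w = w * z) (hz2 : z * z = 1)
    (hzJ : ∀ J : Set B, J ≠ Set.univ → z ∉ parab cs J)
    {a : MonoidAlgebra F W} (ha : a ∈ filt F cs 1) : a ^ (Fintype.card B + 1) = 0 := by
  have h1 : ∀ m, a ^ m ∈ filt F cs m := by
    intro m
    induction m with
    | zero => simpa using one_mem_filt F cs
    | succ m ih =>
      rw [pow_succ']
      exact filt_one_mul F cs z hz hz2 hzJ ha ih
  have h2 := h1 (Fintype.card B + 1)
  have h3 : {L : Set B | L.ncard + (Fintype.card B + 1) ≤ Fintype.card B} = ∅ := by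
    ext L; simp
    omega
  rw [filt, h3] at h2
  simpa using h2

lemma mem_descentAlgebra_iff (a : MonoidAlgebra F W) :
    a ∈ descentAlgebra F cs ↔ a ∈ filt F cs 0 := by
  constructor
  · intro h
    induction h using Algebra.adjoin_induction with
    | mem x hx =>
      obtain ⟨J, rfl⟩ := hx
      exact descentElt_mem_filt F cs (ncard_le _)
    | algebraMap r =>
      rw [Algebra.algebraMap_eq_smul_one]
      exact Submodule.smul_mem _ _ (one_mem_filt F cs)
    | add x y _ _ hx hy => exact Submodule.add_mem _ hx hy
    | mul x y _ _ hx hy => exact filt_zero_mul F cs hx hy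
  · intro h
    have : filt F cs 0 ≤ Subalgebra.toSubmodule (descentAlgebra F cs) := by
      rw [filt, Submodule.span_le]
      rintro _ ⟨J, -, rfl⟩
      exact Algebra.subset_adjoin ⟨J, rfl⟩
    exact this h

lemma filt_anti {k l : ℕ} (h : k ≤ l) : filt F cs l ≤ filt F cs k := by
  refine Submodule.span_mono (Set.image_mono ?_)
  intro L hL
  simp only [Set.mem_ofPred_eq] at hL ⊢
  omega

lemma filt_zero_decomp {a : MonoidAlgebra F W} (ha : a ∈ filt F cs 0) :
    ∃ c : F, a - c • (1 : MonoidAlgebra F W) ∈ filt F cs 1 := by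
  induction ha using Submodule.span_induction with
  | mem x hx =>
    obtain ⟨L, -, rfl⟩ := hx
    by_cases h : L = Set.univ
    · subst h
      exact ⟨1, by simp [descentElt_univ]⟩
    · exact ⟨0, by simpa using descentElt_mem_filt F cs (ncard_lt h)⟩
  | zero => exact ⟨0, by simp⟩
  | add x y _ _ hx hy =>
    obtain ⟨c, hc⟩ := hx
    obtain ⟨d, hd⟩ := hy
    refine ⟨c + d, ?_⟩
    have := Submodule.add_mem _ hc hd
    rwa [show x + y - (c + d) • (1 : MonoidAlgebra F W) =
      x - c • (1 : MonoidAlgebra F W) + (y - d • (1 : MonoidAlgebra F W)) by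
        rw [add_smul]; abel]
  | smul r x _ hx =>
    obtain ⟨c, hc⟩ := hx
    refine ⟨r * c, ?_⟩
    rw [mul_smul, ← smul_sub]
    exact Submodule.smul_mem _ _ hc

open Classical in
lemma count_zero [CharP F 2] {L : Set B} (hL : L.ncard + 2 ≤ Fintype.card B) (i : B) :
    ∑ K : Finset B, (if i ∈ K ∧ ∀ j ∈ L, j ∉ K then (1 : F) else 0) = 0 := by
  obtain ⟨k, hk⟩ : ∃ k, k ∉ insert i L := by
    by_contra! h
    have h1 : insert i L = Set.univ := Set.eq_univ_of_forall h
    have h2 := Set.ncard_insert_le i L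
    rw [h1, Set.ncard_univ, Nat.card_eq_fintype_card] at h2
    omega
  simp only [Set.mem_insert_iff, not_or] at hk
  refine Finset.sum_involution (fun K _ => symmDiff K {k}) ?_ ?_ ?_ ?_
  · intro K _
    have e : (i ∈ symmDiff K {k} ∧ ∀ j ∈ L, j ∉ symmDiff K {k}) ↔ (i ∈ K ∧ ∀ j ∈ L, j ∉ K) := by
      have h1 : ∀ j, j ≠ k → (j ∈ symmDiff K {k} ↔ j ∈ K) := by
        intro j hj
        simp [Finset.mem_symmDiff, hj]
      refine and_congr (h1 i fun h => hk.1 h.symm) (forall₂_congr fun j hj => ?_)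
      rw [h1 j]
      rintro rfl
      exact hk.2 hj
    simp only [e]
    exact CharTwo.add_self_eq_zero _
  · intro K _ _ h
    simp at h
  · intro K _
    exact Finset.mem_univ _
  · intro K _
    simp [symmDiff_assoc]

open Classical in
lemma count_single (i j : B) :
    ∑ K : Finset B, (if i ∈ K ∧ ∀ l ∈ ({j}ᶜ : Set B), l ∉ K then (1 : F) else 0) =
      if i = j then 1 else 0 := by
  have h : ∀ K : Finset B, (i ∈ K ∧ ∀ l ∈ ({j}ᶜ : Set B), l ∉ K) ↔ (i = j ∧ K = {j}) := by
    intro K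
    constructor
    · rintro ⟨h1, h2⟩
      have h3 : ∀ l ∈ K, l = j := by
        intro l hl
        by_contra hlj
        exact h2 l hlj hl
      have := h3 i h1
      subst this
      exact ⟨rfl, Finset.eq_singleton_iff_unique_mem.2 ⟨h1, h3⟩⟩
    · rintro ⟨rfl, rfl⟩
      simp
  simp only [h]
  by_cases hij : i = j
  · simp [hij]
  · simp [hij]

/-- The abstract form of the main theorem. -/
theorem descent_main [CharP F 2] (z : W) (hz : ∀ w, z * w = w * z) (hz2 : z * z = 1)
    (hzJ : ∀ J : Set B, J ≠ Set.univ → z ∉ parab cs J)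
    (hs : ∀ (i : B) (K : Set B), i ∉ K → cs.simple i ∉ parab cs K) :
    quotDim F (descentAlgebra F cs) (⊥ : Ideal (descentAlgebra F cs)).jacobson = 1 ∧
      Fintype.card B ≤ subquotDim F (descentAlgebra F cs)
        (⊥ : Ideal (descentAlgebra F cs)).jacobson
        ((⊥ : Ideal (descentAlgebra F cs)).jacobson •
          (⊥ : Ideal (descentAlgebra F cs)).jacobson) := by
  classical
  set Jac := (⊥ : Ideal (descentAlgebra F cs)).jacobson with hJac
  have hD : ∀ a : descentAlgebra F cs, (a : MonoidAlgebra F W) ∈ filt F cs 0 := fun a =>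
    (mem_descentAlgebra_iff F cs _).1 a.2
  have h1 : ∀ a : descentAlgebra F cs, (a : MonoidAlgebra F W) ∈ filt F cs 1 → a ∈ Jac := by
    intro a ha
    rw [hJac, Ideal.mem_jacobson_iff]
    intro y
    have hn : IsNilpotent (y * a) := by
      refine ⟨Fintype.card B + 1, Subtype.ext ?_⟩
      have := filt_nilp F cs z hz hz2 hzJ (filt_zero_mul F cs (hD y) ha)
      simpa using this
    obtain ⟨v, hv⟩ := hn.isUnit_add_one
    refine ⟨((v⁻¹ : (descentAlgebra F cs)ˣ) : descentAlgebra F cs), ?_⟩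
    have : ((v⁻¹ : (descentAlgebra F cs)ˣ) : descentAlgebra F cs) * (y * a + 1) = 1 := by
      rw [← hv]; simp
    rw [mul_add, mul_one, ← mul_assoc] at this
    rw [this, sub_self]
    exact Submodule.zero_mem _
  have hne : Jac ≠ ⊤ := by
    rw [hJac, Ne, Ideal.jacobson_eq_top_iff]
    exact bot_ne_top
  have hone : (1 : descentAlgebra F cs) ∉ Jac := fun h => hne ((Ideal.eq_top_iff_one _).2 h)
  have hdec : ∀ a : descentAlgebra F cs, ∃ c : F, ((a - c • 1 : descentAlgebra F cs) :
      MonoidAlgebra F W) ∈ filt F cs 1 := by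
    intro a
    obtain ⟨c, hc⟩ := filt_zero_decomp F cs (hD a)
    exact ⟨c, by simpa using hc⟩
  have h2 : ∀ a ∈ Jac, (a : MonoidAlgebra F W) ∈ filt F cs 1 := by
    intro a ha
    obtain ⟨c, hc⟩ := hdec a
    by_cases hc0 : c = 0
    · simpa [hc0] using hc
    · exfalso
      have h3 := Jac.sub_mem ha (h1 _ hc)
      rw [sub_sub_cancel] at h3
      have h4 := Jac.mul_mem_left (c⁻¹ • (1 : descentAlgebra F cs)) h3
      rw [smul_mul_smul_comm, inv_mul_cancel₀ hc0, one_smul, one_mul] at h4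
      exact hone h4
  refine ⟨?_, ?_⟩
  · unfold quotDim
    refine finrank_eq_one (Submodule.Quotient.mk (1 : descentAlgebra F cs)) ?_ ?_
    · rw [Ne, Submodule.Quotient.mk_eq_zero]
      exact hone
    · intro w
      obtain ⟨a, rfl⟩ := Submodule.Quotient.mk_surjective _ w
      obtain ⟨c, hc⟩ := hdec a
      refine ⟨c, ?_⟩
      rw [← Submodule.Quotient.mk_smul, eq_comm, Submodule.Quotient.eq]
      exact h1 _ hc
  · choose dw hdw using exists_descent cs hs
    have hmem : ∀ K L : Set B, dw K ∈ XJ cs L ↔ ∀ j ∈ L, j ∉ K := fun K L =>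
      forall₂_congr fun j _ => hdw K j
    -- the functionals
    let cf : W → MonoidAlgebra F W →ₗ[F] F := fun w =>
      { toFun := fun a => a.coeff w
        map_add' := fun a b => by simp
        map_smul' := fun c a => by simp }
    let fi : MonoidAlgebra F W →ₗ[F] (B → F) := LinearMap.pi fun i =>
      ∑ K : Finset B, if i ∈ K then cf (dw K) else 0
    have hfi : ∀ (L : Set B) (i : B), fi (descentElt F cs L) i =
        ∑ K : Finset B, (if i ∈ K ∧ ∀ j ∈ L, j ∉ K then (1 : F) else 0) := by
      intro L i
      simp only [fi, LinearMap.pi_apply, LinearMap.sum_apply]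
      refine Finset.sum_congr rfl fun K _ => ?_
      by_cases hi : i ∈ K
      · simp only [hi, if_true, true_and]
        change (descentElt F cs L).coeff (dw K) = _
        rw [coeff_descentElt]
        simp only [hmem, Finset.mem_coe]
      · simp [hi]
    have hfi2 : ∀ a ∈ filt F cs 2, fi a = 0 := by
      intro a ha
      have : filt F cs 2 ≤ LinearMap.ker fi := by
        rw [filt, Submodule.span_le]
        rintro _ ⟨L, hL, rfl⟩
        rw [SetLike.mem_coe, LinearMap.mem_ker]
        funext i
        rw [hfi, count_zero F hL]
        rfl
      exact this ha
    let g : (Jac.restrictScalars F) →ₗ[F] (B → F) :=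
      fi ∘ₗ (descentAlgebra F cs).val.toLinearMap ∘ₗ (Jac.restrictScalars F).subtype
    have hker : Submodule.comap (Jac.restrictScalars F).subtype
        ((Jac • Jac).restrictScalars F) ≤ LinearMap.ker g := by
      intro a ha
      rw [LinearMap.mem_ker]
      refine hfi2 _ ?_
      have ha' : (a : descentAlgebra F cs) ∈ Jac • Jac := ha
      change ((a : descentAlgebra F cs) : MonoidAlgebra F W) ∈ filt F cs 2
      exact Submodule.smul_induction_on
        (p := fun x : descentAlgebra F cs => (x : MonoidAlgebra F W) ∈ filt F cs 2) ha'
        (fun r hr x hx => filt_one_mul F cs z hz hz2 hzJ (h2 r hr) (h2 x hx))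
        (fun x y hx hy => Submodule.add_mem _ hx hy)
    have hsurj : Function.Surjective g := by
      rw [← LinearMap.range_eq_top, eq_top_iff, ← (Pi.basisFun F B).span_eq, Submodule.span_le]
      rintro _ ⟨j, rfl⟩
      have hx : descentElt F cs ({j}ᶜ : Set B) ∈ filt F cs 1 :=
        descentElt_mem_filt F cs (ncard_lt (by simp))
      refine ⟨⟨⟨descentElt F cs ({j}ᶜ : Set B), Algebra.subset_adjoin ⟨_, rfl⟩⟩, h1 _ hx⟩, ?_⟩
      change fi (descentElt F cs ({j}ᶜ : Set B)) = _
      funext i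
      rw [hfi]
      refine Eq.trans (Finset.sum_congr rfl fun K _ => by congr)
        ((count_single F i j).trans ?_)
      simp [Pi.single_apply]
    have : Module.Finite F (MonoidAlgebra F W) := Module.Finite.of_basis (MonoidAlgebra.basis W F)
    have : Module.Finite F (descentAlgebra F cs) :=
      inferInstanceAs (Module.Finite F (Subalgebra.toSubmodule (descentAlgebra F cs)))
    exact subquot_lower F (descentAlgebra F cs) Jac (Jac • Jac) g (fun a ha => hker ha) hsurj

end Algebra

section DGroup

variable {G : Type*} [Group G]

/-- The braid relations of type `D_n`, for a family indexed by natural numbers. -/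
structure DRel (n : ℕ) (t : ℕ → G) : Prop where
  sq : ∀ i, t i * t i = 1
  c01 : Commute (t 0) (t 1)
  comm : ∀ i j, i + 2 ≤ j → 3 ≤ j → Commute (t i) (t j)
  br : ∀ i, 1 ≤ i → i + 1 < n → t i * t (i + 1) * t i = t (i + 1) * t i * t (i + 1)
  br02 : t 0 * t 2 * t 0 = t 2 * t 0 * t 2

/-- The element that negates the coordinates `0` and `k + 1`. -/
def bb (t : ℕ → G) : ℕ → G
  | 0 => t 0 * t 1
  | k + 1 => t (k + 2) * bb t k * t (k + 2)

/-- The product of the first `m` elements `bb`. -/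
def zz (t : ℕ → G) : ℕ → G
  | 0 => 1
  | m + 1 => zz t m * bb t m

theorem cancel_left {a : G} (h : a * a = 1) (x : G) : a * (a * x) = x := by
  rw [← mul_assoc, h, one_mul]

theorem br_aux {a c x : G} (h : a * c * a = c * a * c) (hx : Commute c x) :
    Commute a (c * (a * x * a) * c) := by
  unfold Commute SemiconjBy at *
  calc a * (c * (a * x * a) * c) = (a * c * a) * x * a * c := by group
    _ = c * a * (c * x) * a * c := by rw [h]; group
    _ = c * a * x * (c * a * c) := by rw [hx]; group
    _ = _ := by rw [← h]; group

variable {n : ℕ} {t : ℕ → G}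

theorem bb_sq (h : DRel n t) (k : ℕ) : bb t k * bb t k = 1 := by
  induction k with
  | zero =>
    change t 0 * t 1 * (t 0 * t 1) = 1
    rw [mul_assoc, ← mul_assoc (t 1), ← h.c01.eq, mul_assoc (t 0), h.sq, mul_one, h.sq]
  | succ k ih =>
    change t (k + 2) * bb t k * t (k + 2) * (t (k + 2) * bb t k * t (k + 2)) = 1
    simp only [mul_assoc]
    rw [cancel_left (h.sq _), cancel_left ih, h.sq]

theorem bb_far (h : DRel n t) (k : ℕ) : ∀ i, k + 3 ≤ i → Commute (t i) (bb t k) := by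
  induction k with
  | zero =>
    intro i hi
    exact ((h.comm 0 i (by omega) (by omega)).symm).mul_right
      ((h.comm 1 i (by omega) (by omega)).symm)
  | succ k ih =>
    intro i hi
    have := (h.comm (k + 2) i (by omega) (by omega)).symm
    exact (this.mul_right (ih i (by omega))).mul_right this

theorem bb_near (h : DRel n t) (k : ℕ) : t (k + 2) * bb t k = bb t (k + 1) * t (k + 2) := by
  change _ = t (k + 2) * bb t k * t (k + 2) * t (k + 2)
  rw [mul_assoc _ (t (k + 2)) (t (k + 2)), h.sq, mul_one]

theorem bb_near' (h : DRel n t) (k : ℕ) : t (k + 2) * bb t (k + 1) = bb t k * t (k + 2) := by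
  change t (k + 2) * (t (k + 2) * bb t k * t (k + 2)) = _
  rw [mul_assoc, cancel_left (h.sq _)]

theorem bb_low (h : DRel n t) (k : ℕ) :
    ∀ i, 2 ≤ i → i ≤ k → k + 1 < n → Commute (t i) (bb t k) := by
  induction k with
  | zero => intro i h1 h2; omega
  | succ k ih =>
    intro i h1 h2 h3
    rcases Nat.lt_or_ge k i with hk | hk
    · obtain rfl : i = k + 1 := by omega
      obtain ⟨m, rfl⟩ : ∃ m, k = m + 1 := ⟨k - 1, by omega⟩
      exact br_aux (h.br (m + 2) (by omega) (by omega)) (bb_far h m _ (by omega))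
    · have := h.comm i (k + 2) (by omega) (by omega)
      exact (this.mul_right (ih i h1 hk (by omega))).mul_right this

theorem bb_conj1 (h : DRel n t) (hn : 3 ≤ n) (k : ℕ) :
    t 1 * bb t (k + 1) = bb t 0 * bb t (k + 1) * t 1 := by
  induction k with
  | zero =>
    have h12 := h.br 1 le_rfl (by omega)
    have h01 := h.c01.eq
    change t 1 * (t 2 * (t 0 * t 1) * t 2) = (t 0 * t 1) * (t 2 * (t 0 * t 1) * t 2) * t 1
    symm
    calc (t 0 * t 1) * (t 2 * (t 0 * t 1) * t 2) * t 1
        = t 0 * t 1 * t 2 * t 0 * (t 1 * t 2 * t 1) := by simp only [mul_assoc]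
      _ = t 0 * t 1 * (t 2 * t 0 * t 2) * t 1 * t 2 := by rw [h12]; simp only [mul_assoc]
      _ = (t 0 * t 1) * t 0 * t 2 * t 0 * t 1 * t 2 := by rw [← h.br02]; simp only [mul_assoc]
      _ = t 1 * (t 0 * t 0) * t 2 * t 0 * t 1 * t 2 := by rw [h01]; simp only [mul_assoc]
      _ = _ := by rw [h.sq]; simp only [mul_assoc, mul_one]
  | succ k ih =>
    have c1 := (h.comm 1 (k + 3) (by omega) (by omega)).eq
    have c2 := (bb_far h 0 (k + 3) (by omega)).eq
    change t 1 * (t (k + 3) * bb t (k + 1) * t (k + 3)) =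
      bb t 0 * (t (k + 3) * bb t (k + 1) * t (k + 3)) * t 1
    calc t 1 * (t (k + 3) * bb t (k + 1) * t (k + 3))
        = (t 1 * t (k + 3)) * bb t (k + 1) * t (k + 3) := by simp only [mul_assoc]
      _ = t (k + 3) * (t 1 * bb t (k + 1)) * t (k + 3) := by rw [c1]; simp only [mul_assoc]
      _ = (t (k + 3) * bb t 0) * bb t (k + 1) * (t 1 * t (k + 3)) := by
        rw [ih]; simp only [mul_assoc]
      _ = _ := by rw [c1, c2]; simp only [mul_assoc]

theorem bb_conj0 (h : DRel n t) (hn : 3 ≤ n) (k : ℕ) :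
    t 0 * bb t (k + 1) = bb t 0 * bb t (k + 1) * t 0 := by
  induction k with
  | zero =>
    have h12 := h.br 1 le_rfl (by omega)
    have h01 := h.c01.eq
    change t 0 * (t 2 * (t 0 * t 1) * t 2) = (t 0 * t 1) * (t 2 * (t 0 * t 1) * t 2) * t 0
    symm
    calc (t 0 * t 1) * (t 2 * (t 0 * t 1) * t 2) * t 0
        = t 0 * t 1 * t 2 * (t 0 * t 1) * t 2 * t 0 := by simp only [mul_assoc]
      _ = t 0 * t 1 * t 2 * t 1 * (t 0 * t 2 * t 0) := by rw [h01]; simp only [mul_assoc]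
      _ = t 0 * t 1 * (t 2 * t 1 * t 2) * t 0 * t 2 := by rw [h.br02]; simp only [mul_assoc]
      _ = t 0 * (t 1 * t 1) * t 2 * (t 1 * t 0) * t 2 := by rw [← h12]; simp only [mul_assoc]
      _ = _ := by rw [h.sq, ← h01]; simp only [mul_assoc, mul_one, one_mul]
  | succ k ih =>
    have c1 := (h.comm 0 (k + 3) (by omega) (by omega)).eq
    have c2 := (bb_far h 0 (k + 3) (by omega)).eq
    change t 0 * (t (k + 3) * bb t (k + 1) * t (k + 3)) =
      bb t 0 * (t (k + 3) * bb t (k + 1) * t (k + 3)) * t 0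
    calc t 0 * (t (k + 3) * bb t (k + 1) * t (k + 3))
        = (t 0 * t (k + 3)) * bb t (k + 1) * t (k + 3) := by simp only [mul_assoc]
      _ = t (k + 3) * (t 0 * bb t (k + 1)) * t (k + 3) := by rw [c1]; simp only [mul_assoc]
      _ = (t (k + 3) * bb t 0) * bb t (k + 1) * (t 0 * t (k + 3)) := by
        rw [ih]; simp only [mul_assoc]
      _ = _ := by rw [c1, c2]; simp only [mul_assoc]

theorem bb_comm0 (h : DRel n t) (hn : 3 ≤ n) (k : ℕ) : Commute (bb t 0) (bb t k) := by
  cases k with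
  | zero => exact Commute.refl _
  | succ k =>
    have h1 : bb t 0 * bb t (k + 1) = t 1 * bb t (k + 1) * t 1 := by
      rw [bb_conj1 h hn k, mul_assoc _ (t 1) (t 1), h.sq, mul_one]
    have h2 : (bb t 0 * bb t (k + 1)) * (bb t 0 * bb t (k + 1)) = 1 := by
      rw [h1]
      simp only [mul_assoc]
      rw [cancel_left (h.sq _), cancel_left (bb_sq h _), h.sq]
    have h3 : (bb t (k + 1) * bb t 0) * (bb t 0 * bb t (k + 1)) = 1 := by
      simp only [mul_assoc]
      rw [cancel_left (bb_sq h _), bb_sq h]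
    exact mul_right_cancel (h2.trans h3.symm)

theorem bb_comm (h : DRel n t) (hn : 3 ≤ n) (l : ℕ) (hl : l + 1 < n) :
    ∀ k, k ≤ l → Commute (bb t k) (bb t l) := by
  intro k
  induction k with
  | zero => intro _; exact bb_comm0 h hn l
  | succ k ih =>
    intro hk
    rcases Nat.lt_or_ge (k + 1) l with hk2 | hk2
    · have := bb_low h l (k + 2) (by omega) (by omega) hl
      exact (this.mul_left (ih (by omega))).mul_left this
    · obtain rfl : l = k + 1 := by omega
      exact Commute.refl _

theorem zz_bb (h : DRel n t) (hn : 3 ≤ n) (l : ℕ) (hl : l + 1 < n) :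
    ∀ m, m ≤ l → Commute (zz t m) (bb t l) := by
  intro m
  induction m with
  | zero => intro _; exact Commute.one_left _
  | succ m ih => intro hm; exact (ih (by omega)).mul_left (bb_comm h hn l hl m (by omega))

theorem zz_sq (h : DRel n t) (hn : 3 ≤ n) (m : ℕ) (hm : m < n) : zz t m * zz t m = 1 := by
  induction m with
  | zero => exact mul_one _
  | succ m ih =>
    change zz t m * bb t m * (zz t m * bb t m) = 1
    rw [mul_assoc, ← mul_assoc (bb t m), ← (zz_bb h hn m hm m le_rfl).eq, mul_assoc (zz t m),
      bb_sq h, mul_one, ih (by omega)]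

theorem zz_far (h : DRel n t) (m : ℕ) : ∀ i, m + 2 ≤ i → Commute (t i) (zz t m) := by
  induction m with
  | zero => intro i _; exact Commute.one_right _
  | succ m ih => intro i hi; exact (ih i (by omega)).mul_right (bb_far h m i (by omega))

theorem zz_low (h : DRel n t) (hn : 3 ≤ n) (m : ℕ) :
    ∀ i, 2 ≤ i → i ≤ m → m < n → Commute (t i) (zz t m) := by
  induction m with
  | zero => intro i h1 h2; omega
  | succ m ih =>
    intro i h1 h2 h3
    rcases Nat.lt_or_ge m i with hk | hk
    · obtain rfl : i = m + 1 := by omega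
      obtain ⟨q, rfl⟩ : ∃ q, m = q + 1 := ⟨m - 1, by omega⟩
      have e : zz t (q + 1 + 1) = zz t q * (bb t q * bb t (q + 1)) := mul_assoc _ _ _
      rw [e]
      refine (zz_far h q _ (by omega)).mul_right ?_
      change t (q + 2) * (bb t q * bb t (q + 1)) = bb t q * bb t (q + 1) * t (q + 2)
      rw [← mul_assoc, bb_near h, mul_assoc, bb_near' h, ← mul_assoc,
        (bb_comm h hn (q + 1) h3 q (by omega)).eq]
    · exact (ih i h1 hk (by omega)).mul_right (bb_low h m i h1 hk h3)

theorem zz_odd (h : DRel n t) (hn : 3 ≤ n) (s : G) (hs0 : Commute s (bb t 0))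
    (hs : ∀ k, s * bb t (k + 1) = bb t 0 * bb t (k + 1) * s) (q : ℕ) :
    Commute s (zz t (2 * q + 1)) := by
  induction q with
  | zero => exact (Commute.one_right _).mul_right hs0
  | succ q ih =>
    have e : zz t (2 * (q + 1) + 1) = zz t (2 * q + 1) * (bb t (2 * q + 1) * bb t (2 * q + 2)) :=
      mul_assoc _ _ _
    rw [e]
    refine ih.mul_right ?_
    change s * (bb t (2 * q + 1) * bb t (2 * q + 2)) = _
    rw [← mul_assoc, hs, mul_assoc _ s, hs, (bb_comm0 h hn (2 * q + 1)).eq]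
    simp only [mul_assoc]
    rw [cancel_left (bb_sq h _)]

theorem zz_central (h : DRel n t) (hn : 3 ≤ n) (he : Even n) (i : ℕ) (hi : i < n) :
    Commute (t i) (zz t (n - 1)) := by
  have h0 : Commute (t 0) (bb t 0) := (Commute.refl _).mul_right h.c01
  have h1 : Commute (t 1) (bb t 0) := h.c01.symm.mul_right (Commute.refl _)
  obtain ⟨r, hr⟩ := he
  have e : n - 1 = 2 * (r - 1) + 1 := by omega
  match i, hi with
  | 0, _ => rw [e]; exact zz_odd h hn _ h0 (bb_conj0 h hn) _
  | 1, _ => rw [e]; exact zz_odd h hn _ h1 (bb_conj1 h hn) _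
  | i + 2, hi => exact zz_low h hn (n - 1) (i + 2) (by omega) (by omega) (by omega)


end DGroup
section DRep

/-- The linear functional attached to the `i`-th simple root of type `D`. -/
def rootL : ℕ → (ℕ → ℤ) → ℤ
  | 0, v => v 0 + v 1
  | i + 1, v => v (i + 1) - v i

/-- The `i`-th simple root of type `D`. -/
def rootV : ℕ → ℕ → ℤ
  | 0, k => if k = 0 then 1 else if k = 1 then 1 else 0
  | i + 1, k => if k = i + 1 then 1 else if k = i then -1 else 0

/-- The reflection in the `i`-th simple root. -/
def rootS (i : ℕ) : Function.End (ℕ → ℤ) := fun v k => v k - rootL i v * rootV i k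

theorem rootL_sub (i j : ℕ) (v : ℕ → ℤ) (c : ℤ) :
    rootL i (fun k => v k - c * rootV j k) = rootL i v - c * rootL i (rootV j) := by
  cases i <;> simp only [rootL] <;> ring

theorem rootL_self (i : ℕ) : rootL i (rootV i) = 2 := by
  cases i <;> simp [rootL, rootV]

theorem rootS_apply (i : ℕ) (v : ℕ → ℤ) : rootS i v = fun k => v k - rootL i v * rootV i k := rfl

theorem rootS_sq (i : ℕ) : rootS i * rootS i = 1 := by
  funext v
  rw [end_mul_apply, end_one_apply, rootS_apply i v, rootS_apply, rootL_sub, rootL_self]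
  funext k
  ring

theorem rootS_comm (i j : ℕ) (h1 : rootL i (rootV j) = 0) (h2 : rootL j (rootV i) = 0) :
    (rootS i * rootS j) ^ 2 = 1 := by
  funext v
  simp only [pow_succ, pow_zero, one_mul, end_mul_apply, end_one_apply, rootS_apply, rootL_sub,
    rootL_self, h1, h2]
  funext k
  ring

theorem rootS_braid (i j : ℕ) (h1 : rootL i (rootV j) = -1) (h2 : rootL j (rootV i) = -1) :
    (rootS i * rootS j) ^ 3 = 1 := by
  funext v
  simp only [pow_succ, pow_zero, one_mul, end_mul_apply, end_one_apply, rootS_apply, rootL_sub,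
    rootL_self, h1, h2]
  funext k
  ring

theorem rootL_cases (i j : ℕ) (hij : i ≠ j) : rootL i (rootV j) =
    if (min i j = 0 ∧ max i j = 2) ∨ (1 ≤ min i j ∧ max i j = min i j + 1) then -1 else 0 := by
  rcases i with _ | i <;> rcases j with _ | j <;> simp only [rootL, rootV] <;>
    split_ifs <;> first | omega | (exfalso; omega)

theorem rootS_liftable (n : ℕ) : (DMat n).IsLiftable (fun i : Fin n => rootS i) := by
  intro i j
  change (rootS i * rootS j) ^ (if i = j then 1
    else if min (i : ℕ) (j : ℕ) = 0 ∧ max (i : ℕ) (j : ℕ) = 2 then 3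
    else if 1 ≤ min (i : ℕ) (j : ℕ) ∧ max (i : ℕ) (j : ℕ) = min (i : ℕ) (j : ℕ) + 1 then 3
    else 2) = 1
  by_cases hij : i = j
  · subst hij
    rw [if_pos rfl, pow_one, rootS_sq]
  · rw [if_neg hij]
    have hij' : (i : ℕ) ≠ j := fun h => hij (Fin.ext h)
    have h1 := rootL_cases i j hij'
    have h2 := rootL_cases j i hij'.symm
    rw [min_comm, max_comm] at h2
    split_ifs with ha hb
    · exact rootS_braid _ _ (h1.trans (if_pos (Or.inl ha))) (h2.trans (if_pos (Or.inl ha)))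
    · exact rootS_braid _ _ (h1.trans (if_pos (Or.inr hb))) (h2.trans (if_pos (Or.inr hb)))
    · exact rootS_comm _ _ (h1.trans (if_neg (by tauto))) (h2.trans (if_neg (by tauto)))

/-- A vector fixed by all simple reflections but the `s`-th one. -/
def fixV (s : ℕ) : ℕ → ℤ := fun k =>
  if s = 0 then 1 else if s = 1 then (if k = 0 then -1 else 1) else if s ≤ k then 1 else 0

theorem rootL_fixV (s j : ℕ) (h : j ≠ s) : rootL j (fixV s) = 0 := by
  rcases j with _ | j <;> simp only [rootL, fixV] <;> split_ifs <;>
    first | omega | (exfalso; omega)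

theorem rootL_fixV_self (s : ℕ) : rootL s (fixV s) ≠ 0 := by
  rcases s with _ | s <;> simp only [rootL, fixV] <;> split_ifs <;>
    first | omega | (exfalso; omega)

theorem rootV_self (s : ℕ) : rootV s s = 1 := by
  cases s <;> simp [rootV]

theorem rootS_zero (v : ℕ → ℤ) (k : ℕ) :
    rootS 0 v k = if k = 0 then - v 1 else if k = 1 then - v 0 else v k := by
  simp only [rootS_apply, rootL, rootV]
  split_ifs with h1 h2
  · subst h1; ring
  · subst h2; ring
  · ring

theorem rootS_succ (i : ℕ) (v : ℕ → ℤ) (k : ℕ) :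
    rootS (i + 1) v k = if k = i + 1 then v i else if k = i then v (i + 1) else v k := by
  simp only [rootS_apply, rootL, rootV]
  split_ifs with h1 h2
  · subst h1; ring
  · subst h2; ring
  · ring

variable {n : ℕ} {W : Type*} [Group W] (cs : CoxeterSystem (DMat n) W)

/-- The simple reflections, indexed by natural numbers. -/
noncomputable def tt (i : ℕ) : W := if h : i < n then cs.simple ⟨i, h⟩ else 1

/-- The reflection representation. -/
noncomputable def rho : W →* Function.End (ℕ → ℤ) := cs.lift ⟨_, rootS_liftable n⟩

theorem rho_simple (i : Fin n) : rho cs (cs.simple i) = rootS i :=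
  cs.lift_apply_simple (rootS_liftable n) i

theorem rho_tt (i : ℕ) (h : i < n) : rho cs (tt cs i) = rootS i := by
  rw [tt, dif_pos h, rho_simple]

theorem rho_bb (hn : 2 ≤ n) (k : ℕ) (hk : k + 1 < n) (v : ℕ → ℤ) (j : ℕ) :
    rho cs (bb (tt cs) k) v j = if j = 0 ∨ j = k + 1 then - v j else v j := by
  induction k generalizing v j with
  | zero =>
    rw [bb, map_mul, end_mul_apply, rho_tt cs 0 (by omega), rho_tt cs 1 (by omega)]
    simp only [rootS_zero, rootS_succ]
    rcases j with _ | _ | j <;> simp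
  | succ k ih =>
    rw [bb, map_mul, map_mul, end_mul_apply, end_mul_apply, rho_tt cs (k + 2) (by omega)]
    rw [rootS_succ]
    simp only [ih (by omega), rootS_succ]
    split_ifs <;> first | omega | (subst_vars; rfl) | grind

theorem rho_zz (hn : 2 ≤ n) (m : ℕ) (hm : m < n) (v : ℕ → ℤ) (j : ℕ) (hj : 1 ≤ j) :
    rho cs (zz (tt cs) m) v j = if j ≤ m then - v j else v j := by
  induction m generalizing v with
  | zero =>
    rw [zz, map_one, end_one_apply, if_neg (by omega)]
  | succ m ih =>
    rw [zz, map_mul, end_mul_apply, ih (by omega), rho_bb cs hn m hm]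
    split_ifs <;> first | omega | rfl

theorem tt_pow (i j : ℕ) (hi : i < n) (hj : j < n) :
    (tt cs i * tt cs j) ^ (if i = j then 1
    else if min i j = 0 ∧ max i j = 2 then 3
    else if 1 ≤ min i j ∧ max i j = min i j + 1 then 3
    else 2) = 1 := by
  have := cs.simple_mul_simple_pow ⟨i, hi⟩ ⟨j, hj⟩
  rw [tt, dif_pos hi, tt, dif_pos hj, ← this]
  congr 1
  change _ = (if (⟨i, hi⟩ : Fin n) = ⟨j, hj⟩ then 1
    else if min i j = 0 ∧ max i j = 2 then 3
    else if 1 ≤ min i j ∧ max i j = min i j + 1 then 3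
    else 2)
  simp only [Fin.mk.injEq]

theorem tt_sq (i : ℕ) : tt cs i * tt cs i = 1 := by
  unfold tt
  split_ifs
  · exact cs.simple_mul_simple_self _
  · exact mul_one _

theorem tt_comm (i j : ℕ) (hij : i ≠ j) (h1 : ¬ (min i j = 0 ∧ max i j = 2))
    (h2 : ¬ (1 ≤ min i j ∧ max i j = min i j + 1)) : Commute (tt cs i) (tt cs j) := by
  by_cases hi : i < n
  · by_cases hj : j < n
    · have := tt_pow cs i j hi hj
      rw [if_neg hij, if_neg h1, if_neg h2, pow_two] at this
      have h3 : (tt cs j * tt cs i) * (tt cs i * tt cs j) = 1 := by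
        rw [mul_assoc, cancel_left (tt_sq cs i), tt_sq]
      exact mul_right_cancel (this.trans h3.symm)
    · rw [tt, tt, dif_neg hj]; exact Commute.one_right _
  · rw [tt, dif_neg hi]; exact Commute.one_left _

theorem braid_of_cube {G : Type*} [Group G] {a b : G} (ha : a * a = 1) (hb : b * b = 1)
    (h : (a * b) ^ 3 = 1) : a * b * a = b * a * b := by
  have h3 : (b * a * b) * (b * a * b) = 1 := by
    simp only [mul_assoc]
    rw [cancel_left hb, cancel_left ha, hb]
  refine mul_right_cancel (b := b * a * b) (Eq.trans ?_ h3.symm)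
  rw [← h]
  simp only [pow_succ, pow_zero, one_mul, mul_assoc]

theorem tt_rel (hn : 3 ≤ n) : DRel n (tt cs) where
  sq := tt_sq cs
  c01 := tt_comm cs 0 1 (by omega) (by omega) (by omega)
  comm := fun i j h1 h2 => tt_comm cs i j (by omega) (by omega) (by omega)
  br := fun i h1 h2 => by
    have := tt_pow cs i (i + 1) (by omega) h2
    rw [if_neg (by omega), if_neg (by omega), if_pos (by omega)] at this
    exact braid_of_cube (tt_sq cs _) (tt_sq cs _) this
  br02 := by
    have := tt_pow cs 0 2 (by omega) (by omega)
    rw [if_neg (by omega), if_pos (by omega)] at this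
    exact braid_of_cube (tt_sq cs _) (tt_sq cs _) this

theorem parab_fix (s : Fin n) (K : Set (Fin n)) (hs : s ∉ K) (w : W) (hw : w ∈ parab cs K) :
    rho cs w (fixV s) = fixV s := by
  unfold parab at hw
  induction hw using Subgroup.closure_induction with
  | mem x hx =>
    obtain ⟨j, hj, rfl⟩ := hx
    have hne : (j : ℕ) ≠ s := fun h => hs (Fin.ext h ▸ hj)
    rw [rho_simple, rootS_apply, rootL_fixV _ _ hne]
    funext k
    ring
  | one => rw [map_one, end_one_apply]
  | mul x y _ _ hx hy => rw [map_mul, end_mul_apply, hy, hx]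
  | inv x _ hx =>
    have : rho cs (x⁻¹ * x) (fixV s) = fixV s := by
      rw [inv_mul_cancel, map_one, end_one_apply]
    rwa [map_mul, end_mul_apply, hx] at this

theorem simple_notMem_parab (s : Fin n) (K : Set (Fin n)) (hs : s ∉ K) :
    cs.simple s ∉ parab cs K := by
  intro h
  have h1 := congrFun (parab_fix cs s K hs _ h) s
  rw [rho_simple, rootS_apply] at h1
  simp only [rootV_self, mul_one, sub_eq_self] at h1
  exact rootL_fixV_self s h1

theorem zz_notMem_parab (hn : 2 ≤ n) (K : Set (Fin n)) (hK : K ≠ Set.univ) :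
    zz (tt cs) (n - 1) ∉ parab cs K := by
  intro h
  obtain ⟨s, hs⟩ := (Set.ne_univ_iff_exists_notMem K).1 hK
  have h1 := congrFun (parab_fix cs s K hs _ h) (n - 1)
  rw [rho_zz cs hn _ (by omega) _ _ (by omega), if_pos le_rfl] at h1
  have h2 : fixV s (n - 1) = 1 := by
    have := s.2
    simp only [fixV]
    split_ifs <;> omega
  omega

theorem zz_comm (hn : 3 ≤ n) (he : Even n) (w : W) :
    zz (tt cs) (n - 1) * w = w * zz (tt cs) (n - 1) := by
  induction w using cs.simple_induction with
  | simple i =>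
    have := zz_central (tt_rel cs hn) hn he i i.2
    rw [tt, dif_pos i.2] at this
    exact this.eq.symm
  | one => rw [mul_one, one_mul]
  | mul x y hx hy => rw [← mul_assoc, hx, mul_assoc, hy, mul_assoc]

end DRep

/-- If `char F = 2` and `n ≥ 4` is even, the descent algebra `D = D_F(D_n)` has a unique simple
module (`D/J(D)` is one-dimensional over `F`), and `dim_F J(D)/J(D)² ≥ n`: the Ext-quiver of
`D_F(D_n)` is a single vertex with at least `n` loops. -/
theorem stmt_12 (F : Type*) [Field F] (n : ℕ) (hn : 4 ≤ n) (hneven : Even n)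
    (W : Type*) [Group W] [Fintype W] (cs : CoxeterSystem (DMat n) W)
    (hchar : ringChar F = 2)
    (D : Subalgebra F (MonoidAlgebra F W)) (hD : D = descentAlgebra F cs)
    (Jac : Ideal ↥D) (hJac : Jac = (⊥ : Ideal ↥D).jacobson) :
    quotDim F ↥D Jac = 1 ∧ n ≤ subquotDim F ↥D Jac (Jac • Jac) := by
  subst hD hJac
  haveI : CharP F 2 := hchar ▸ ringChar.charP F
  have key := descent_main F cs (zz (tt cs) (n - 1)) (zz_comm cs (by omega) hneven)
    (zz_sq (tt_rel cs (by omega)) (by omega) _ (by omega))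
    (fun K hK => zz_notMem_parab cs (by omega) K hK)
    (fun i K hi => simple_notMem_parab cs i K hi)
  rw [Fintype.card_fin] at key
  exact key
end
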